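/- arXiv:1706.09154 — 2 statements merged into one kernel-verified Lean document; each statement's English description precedes it below -/
import Mathlib

section
/- Let k ≥ 1. Then for all natural numbers d, m with m ≥ d ≥ 1, every l ≥ k, and every r ≥ 2 there exists a natural number n such that for every colouring c: FIN_k^{*(d)}(n) → {1,…,r} there is B = (b₁,…,b_m) ∈ FIN_l^{*(m)}(n) such that the set ⟨⋃_{ī∈P_{k+1}^l} T_ī(B)⟩_{P_k}^{*(d)} is c-monochromatic. -/
/-- The support of `p : ℕ → ℕ`. -/
def fsupp (p : ℕ → ℕ) : Set ℕ := {x | p x ≠ 0}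

/-- `p ∈ FIN_k(n)`: `p` takes values in `{0,…,k}`, its support is contained in
`{1,…,n}`, and `p` attains the value `k`. -/
def memFIN (k n : ℕ) (p : ℕ → ℕ) : Prop :=
  (∀ x, p x ≤ k) ∧ (∀ x, p x ≠ 0 → 1 ≤ x ∧ x ≤ n) ∧ ∃ x, p x = k

/-- `(p₁,…,p_d) ∈ FIN_k^{*(d)}(n)`: each `p_i ∈ FIN_k(n)`, the supports are pairwise
disjoint, and `min supp_k(p_i) < min supp(p_{i+1})` for each `i < d`. -/
def memFINstar (k d n : ℕ) (p : Fin d → ℕ → ℕ) : Prop :=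
  (∀ i, memFIN k n (p i)) ∧
  (∀ i j : Fin d, i ≠ j → ∀ x, p i x = 0 ∨ p j x = 0) ∧
  ∀ i : Fin d, ∀ h : i.val + 1 < d,
    sInf {x | p i x = k} < sInf {x | p ⟨i.val + 1, h⟩ x ≠ 0}

/-- The generalized tetris operation `T_i` (for `i = 0` this is the identity). -/
def Tet (i : ℕ) (p : ℕ → ℕ) : ℕ → ℕ :=
  fun x => if 0 < i ∧ i ≤ p x then p x - 1 else p x

/-- `TetComp k v p = T_{v 0} ∘ T_{v 1} ∘ ⋯ ∘ T_{v (k-1)} (p)`. -/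
def TetComp : (k : ℕ) → (Fin k → ℕ) → (ℕ → ℕ) → (ℕ → ℕ)
  | 0, _, p => p
  | k + 1, v, p => Tet (v 0) (TetComp k (fun j => v j.succ) p)

/-- `v ∈ P_k = ∏_{j=1}^k {0,1,…,j}` (position `j+1` in 0-indexed terms allows `0,…,j+1`). -/
def memP (k : ℕ) (v : Fin k → ℕ) : Prop := ∀ j : Fin k, v j ≤ j.val + 1

/-- `w ∈ P_{k+1}^l = ∏_{j=k+1}^l {1,…,j}`, encoded as a sequence of length `l - k`. -/
def memQ (k l : ℕ) (w : Fin (l - k) → ℕ) : Prop :=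
  ∀ j : Fin (l - k), 1 ≤ w j ∧ w j ≤ k + 1 + j.val

/-- `q ∈ ⟨⋃_{ī ∈ P_{k+1}^l} T_ī(B)⟩_{P_k}`: `q = ∑_{s=1}^m T_{t̄_s}(T_{ī_s}(b_s))` where
`ī_s ∈ P_{k+1}^l`, `t̄_s ∈ P_k`, and for at least one `s` all entries of `t̄_s` are `0`. -/
def memSG (k l m : ℕ) (b : Fin m → ℕ → ℕ) (q : ℕ → ℕ) : Prop :=
  ∃ (iv : Fin m → Fin (l - k) → ℕ) (tv : Fin m → Fin k → ℕ),
    (∀ s, memQ k l (iv s)) ∧ (∀ s, memP k (tv s)) ∧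
    (∃ s, ∀ j, tv s j = 0) ∧
    q = fun x => ∑ s : Fin m, TetComp k (tv s) (TetComp (l - k) (iv s) (b s)) x


/-- parameter words -/
def PW : ℕ → ℕ → List ℕ → Prop
  | a, 0, w => ∀ x ∈ w, x < a
  | a, D + 1, w => ∃ u v, w = u ++ a :: v ∧ (∀ x ∈ u, x < a) ∧ PW (a + 1) D v

/-- substitution of the word `w` for the variables -/
def sbt (a : ℕ) (w : List ℕ) (x : ℕ) : ℕ := if x < a then x else w.getD (x - a) 0

theorem PW_append {a D : ℕ} {u w : List ℕ} (hu : ∀ x ∈ u, x < a) (hw : PW a D w) :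
    PW a D (u ++ w) := by
  cases D with
  | zero =>
    intro x hx
    rcases List.mem_append.1 hx with h | h
    · exact hu x h
    · exact hw x h
  | succ D =>
    obtain ⟨u', v, rfl, h1, h2⟩ := hw
    refine ⟨u ++ u', v, by simp, ?_, h2⟩
    intro x hx
    rcases List.mem_append.1 hx with h | h
    · exact hu x h
    · exact h1 x h

theorem PW_lt {D : ℕ} : ∀ {a : ℕ} {w : List ℕ}, PW a D w → ∀ x ∈ w, x < a + D := by
  induction D with
  | zero => intro a w h x hx; exact h x hx
  | succ D ih =>
    rintro a w ⟨u, v, rfl, h1, h2⟩ x hx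
    rcases List.mem_append.1 hx with h | h
    · have := h1 x h; omega
    · rcases List.mem_cons.1 h with h | h
      · omega
      · have := ih h2 x h; omega

theorem PW_comp {M : ℕ} : ∀ {a a' D : ℕ} {W w : List ℕ} {σ : ℕ → ℕ},
    (∀ x < a, σ x < a') → w.length = M → (∀ j (h : j < w.length), σ (a + j) = w[j]) →
    PW a' D w → PW a M W → PW a' D (W.map σ) := by
  induction M with
  | zero =>
    intro a a' D W w σ h1 h2 h3 h4 h5
    have : w = [] := List.length_eq_zero_iff.1 h2
    subst this
    cases D with
    | zero =>
      intro x hx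
      obtain ⟨y, hy, rfl⟩ := List.mem_map.1 hx
      exact h1 y (h5 y hy)
    | succ D =>
      obtain ⟨u, v, h, _⟩ := h4
      simp at h
  | succ M ih =>
    intro a a' D W w σ h1 h2 h3 h4 h5
    obtain ⟨U, V, rfl, hU, hV⟩ := h5
    cases w with
    | nil => simp at h2
    | cons w0 w' =>
    have hU' : ∀ x ∈ U.map σ, x < a' := by
      intro x hx
      obtain ⟨y, hy, rfl⟩ := List.mem_map.1 hx
      exact h1 y (hU y hy)
    have h0 : σ a = w0 := h3 0 (by simp)
    have h2' : w'.length = M := by simpa using h2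
    have h3' : ∀ j (h : j < w'.length), σ (a + 1 + j) = w'[j] := by
      intro j h
      have := h3 (j + 1) (by simpa using h)
      rw [show a + 1 + j = a + (j + 1) by omega, this]
      simp
    rw [List.map_append, List.map_cons, h0]
    have key : w0 < a' → PW a' D w' → PW a' D (U.map σ ++ w0 :: V.map σ) := by
      intro hlt hw'
      apply PW_append hU'
      apply PW_append (u := [w0]) (by simpa using hlt)
      refine ih ?_ h2' h3' hw' hV
      intro x hx
      rcases Nat.lt_succ_iff_lt_or_eq.1 hx with h | h
      · exact h1 x h
      · subst h; omega
    cases D with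
    | zero =>
      exact key (h4 w0 (by simp)) (fun x hx => h4 x (by simp [hx]))
    | succ D =>
      obtain ⟨u, v, huv, hu, hv⟩ := h4
      cases u with
      | nil =>
        simp only [List.nil_append, List.cons.injEq] at huv
        obtain ⟨rfl, rfl⟩ := huv
        refine ⟨U.map σ, V.map σ, rfl, hU', ?_⟩
        refine ih ?_ h2' h3' hv hV
        intro x hx
        rcases Nat.lt_succ_iff_lt_or_eq.1 hx with h | h
        · have := h1 x h; omega
        · subst h; omega
      | cons u0 u' =>
        simp only [List.cons_append, List.cons.injEq] at huv
        obtain ⟨rfl, rfl⟩ := huv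
        exact key (hu w0 (by simp)) ⟨u', v, rfl, fun x hx => hu x (by simp [hx]), hv⟩

theorem sbt_lt {a x : ℕ} {w : List ℕ} (h : x < a) : sbt a w x = x := by simp [sbt, h]

theorem sbt_add {a j : ℕ} {w : List ℕ} (h : j < w.length) : sbt a w (a + j) = w[j] := by
  simp [sbt, h]

theorem PW_sbt {a D M : ℕ} {W w : List ℕ} (hw : w.length = M) (h : PW a D w) (hW : PW a M W) :
    PW a D (W.map (sbt a w)) :=
  PW_comp (fun x hx => by rwa [sbt_lt hx]) hw (fun j h => sbt_add h) h hW

theorem sbt_assoc {a M : ℕ} {W X w : List ℕ} (hW : PW a M W) (hX : X.length = M) :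
    (W.map (sbt a X)).map (sbt a w) = W.map (sbt a (X.map (sbt a w))) := by
  rw [List.map_map]
  apply List.map_congr_left
  intro x hx
  have := PW_lt hW x hx
  by_cases h : x < a
  · simp [sbt_lt h]
  · obtain ⟨j, rfl⟩ := Nat.exists_eq_add_of_le (not_lt.1 h)
    have hj : j < X.length := by omega
    simp only [Function.comp]
    rw [sbt_add hj, sbt_add (by simpa using hj), List.getElem_map]

theorem PW_split {M : ℕ} : ∀ {a : ℕ} {W : List ℕ} (_ : PW a M W) (i : ℕ) (_ : i < M),
    ∃ P R, W = P ++ (a + i) :: R ∧ (∀ x ∈ P, x < a + i) ∧ PW (a + i + 1) (M - i - 1) R := by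
  induction M with
  | zero => intro a W h i hi; omega
  | succ M ih =>
    rintro a W ⟨u, v, rfl, hu, hv⟩ i hi
    cases i with
    | zero => exact ⟨u, v, rfl, hu, by simpa using hv⟩
    | succ i =>
      obtain ⟨P, R, rfl, hP, hR⟩ := ih hv i (by omega)
      refine ⟨u ++ a :: P, R, by simp; omega, ?_, ?_⟩
      · intro x hx
        rcases List.mem_append.1 hx with h | h
        · have := hu x h; omega
        · rcases List.mem_cons.1 h with h | h
          · omega
          · have := hP x h; omega
      · rw [show a + (i + 1) + 1 = a + 1 + i + 1 by omega,
          show M + 1 - (i + 1) - 1 = M - i - 1 by omega]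
        exact hR

theorem PW_of : ∀ {D a : ℕ} {w : List ℕ}, (∀ x ∈ w, x < a + D) → (0 < D → a + D - 1 ∈ w) →
    (∀ z t : ℕ, w[z]? = some (a + t + 1) → ∃ z' < z, w[z']? = some (a + t)) → PW a D w := by
  intro D
  induction D with
  | zero => intro a w h1 _ _; exact h1
  | succ D ih =>
    intro a w h1 h2 h3
    have key : ∀ t z : ℕ, w[z]? = some (a + t) → ∃ z' ≤ z, w[z']? = some a := by
      intro t
      induction t with
      | zero => intro z hz; exact ⟨z, le_rfl, hz⟩
      | succ t iht =>
        intro z hz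
        obtain ⟨z', hz', h⟩ := h3 z t hz
        obtain ⟨z'', h', h''⟩ := iht z' h
        exact ⟨z'', by omega, h''⟩
    have hD : a + D ∈ w := by simpa using h2 (by omega)
    obtain ⟨z0, hz0⟩ := List.mem_iff_getElem?.1 hD
    obtain ⟨z1, -, hz1⟩ := key D z0 hz0
    have ha : a ∈ w := List.mem_iff_getElem?.2 ⟨z1, hz1⟩
    obtain ⟨u, v, rfl, hau⟩ := List.eq_append_cons_of_mem ha
    have hu : ∀ x ∈ u, x < a := by
      intro x hx
      by_contra hlt
      obtain ⟨t, rfl⟩ := Nat.exists_eq_add_of_le (not_lt.1 hlt)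
      obtain ⟨z, hz⟩ := List.mem_iff_getElem?.1 hx
      have hzl : z < u.length := (List.getElem?_eq_some_iff.1 hz).1
      obtain ⟨z', hz', h'⟩ := key t z (by rw [List.getElem?_append_left hzl]; exact hz)
      rw [List.getElem?_append_left (by omega)] at h'
      exact hau (List.mem_iff_getElem?.2 ⟨z', h'⟩)
    refine ⟨u, v, rfl, hu, ih ?_ ?_ ?_⟩
    · intro x hx
      have := h1 x (by simp [hx])
      omega
    · intro hpos
      rcases List.mem_append.1 hD with h | h
      · have := hu _ h; omega
      · rcases List.mem_cons.1 h with h | h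
        · omega
        · rw [show a + 1 + D - 1 = a + D by omega]; exact h
    · intro z t hz
      obtain ⟨z', hz', h'⟩ := h3 (u.length + (z + 1)) (t + 1) (by
        rw [List.getElem?_append_right (by omega)]
        simpa [show a + (t + 1) + 1 = a + 1 + t + 1 by omega] using hz)
      by_cases hlt : z' < u.length
      · rw [List.getElem?_append_left hlt] at h'
        have := hu _ (List.mem_iff_getElem?.2 ⟨z', h'⟩)
        omega
      · obtain ⟨j, rfl⟩ := Nat.exists_eq_add_of_le (not_lt.1 hlt)
        rw [List.getElem?_append_right (by omega)] at h'
        cases j with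
        | zero => simp at h'
        | succ j =>
          refine ⟨j, by omega, ?_⟩
          simpa [show a + (t + 1) = a + 1 + t by omega] using h'

/-- shift variables by one -/
def shf (a x : ℕ) : ℕ := if x < a then x else x + 1

theorem PW_range' {K : ℕ} : ∀ a, PW a K (List.range' a K) := by
  induction K with
  | zero => intro a x hx; simp at hx
  | succ K ih => intro a; exact ⟨[], _, rfl, by simp, ih (a + 1)⟩

theorem PW_shf {a K : ℕ} {W : List ℕ} (h : PW a K W) : PW (a + 1) K (W.map (shf a)) := by
  refine PW_comp (w := List.range' (a + 1) K) ?_ (by simp) ?_ (PW_range' _) h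
  · intro x hx; simp [shf, hx]; omega
  · intro j hj; simp [shf]; omega

theorem sbt_shf (a e : ℕ) (y : List ℕ) (x : ℕ) : sbt a (e :: y) (shf a x) = sbt a y x := by
  by_cases h : x < a
  · simp [sbt, shf, h]
  · simp [sbt, shf, h, show ¬ x + 1 < a by omega, show x + 1 - a = x - a + 1 by omega]

theorem sbt_shf' (a : ℕ) (y : List ℕ) (x : ℕ) (e : ℕ) :
    sbt (a + 1) y (shf a x) = sbt a (e :: y) (shf a x) := by
  by_cases h : x < a
  · simp [sbt, shf, h, show x < a + 1 by omega]
  · simp [sbt, shf, h, show ¬ x + 1 < a by omega, show x + 1 - a = x - a + 1 by omega]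

theorem HJ_list (a : ℕ) (κ : Type) [Finite κ] : ∃ L : ℕ, ∀ C : List ℕ → κ,
    ∃ Y : List ℕ, Y.length = L ∧ PW a 1 Y ∧ ∃ q, ∀ x < a, C (Y.map (sbt a [x])) = q := by
  obtain ⟨ι, _, hι⟩ := Combinatorics.Line.exists_mono_in_high_dimension (Fin a) κ
  let e := Fintype.equivFin ι
  refine ⟨Fintype.card ι, fun C => ?_⟩
  obtain ⟨l, q, hq⟩ := hι (fun f => C (List.ofFn (fun j => ((f (e.symm j) : Fin a) : ℕ))))
  let Y : List ℕ := List.ofFn (fun j => match l.idxFun (e.symm j) with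
    | none => a
    | some x => (x : ℕ))
  refine ⟨Y, by simp [Y], ?_, q, ?_⟩
  · obtain ⟨i, hi⟩ := l.proper
    have ha : a ∈ Y := by
      simp only [Y, List.mem_ofFn]
      exact ⟨e i, by simp [hi]⟩
    have hle : ∀ x ∈ Y, x ≤ a := by
      intro x hx
      simp only [Y, List.mem_ofFn] at hx
      obtain ⟨j, rfl⟩ := hx
      split <;> omega
    obtain ⟨u, v, huv, hau⟩ := List.eq_append_cons_of_mem ha
    refine ⟨u, v, huv, ?_, ?_⟩
    · intro x hx
      have : x ≠ a := fun h => hau (h ▸ hx)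
      have := hle x (by simp [huv, hx])
      omega
    · intro x hx
      have := hle x (by simp [huv, hx])
      omega
  · intro x hx
    rw [← hq ⟨x, hx⟩]
    congr 1
    simp only [Y, List.map_ofFn]
    congr 1
    funext j
    simp only [Function.comp, Combinatorics.Line.coe_apply]
    cases h : l.idxFun (e.symm j) <;> simp [sbt]

/-- words of length L over a -/
abbrev Wd (a L : ℕ) := {l : List ℕ // l.length = L ∧ ∀ x ∈ l, x < a}

instance (a L : ℕ) : Finite (Wd a L) := by
  refine Finite.of_injective (β := Fin L → Fin a)
    (fun l j => ⟨l.1[j.1]'(by rw [l.2.1]; exact j.2), l.2.2 _ (List.getElem_mem _)⟩) ?_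
  rintro ⟨l, h1, h2⟩ ⟨l', h1', h2'⟩ h
  apply Subtype.ext
  apply List.ext_getElem
  · simp [h1, h1']
  · intro i hi hi'
    have := congrFun h ⟨i, by simp at hi; omega⟩
    simpa using this

theorem CS (a : ℕ) (K : ℕ) : ∀ (κ : Type) [Finite κ], ∃ N : ℕ, ∀ χ : List ℕ → κ,
    ∃ W : List ℕ, W.length = N ∧ PW a K W ∧ ∃ col : ℕ → κ, ∀ i ≤ K, ∀ u : List ℕ, u.length = i →
      (∀ x ∈ u, x < a) → χ ((W.takeWhile (· < a + i)).map (sbt a u)) = col i := by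
  induction K with
  | zero =>
    intro κ _
    refine ⟨0, fun χ => ⟨[], rfl, by simp [PW], fun _ => χ [], ?_⟩⟩
    intros; simp
  | succ K ih =>
    intro κ _
    obtain ⟨L, hL⟩ := HJ_list a (Fin (K + 1) → κ)
    obtain ⟨N, hN⟩ := ih (Wd a L → κ)
    refine ⟨L + N, fun χ => ?_⟩
    obtain ⟨W', hW'l, hW', col', hcol'⟩ := hN (fun y P => χ (P.1 ++ y))
    classical
    have : Nonempty κ := ⟨χ []⟩
    obtain ⟨Y, hYl, hY, q, hq⟩ := hL (fun P i => if h : P.length = L ∧ ∀ x ∈ P, x < a then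
      col' i ⟨P, h⟩ else Classical.arbitrary κ)
    obtain ⟨s, t, hst, hs, ht⟩ := id hY
    have hYa : ∀ x ∈ Y, x < a + 1 := PW_lt hY
    refine ⟨Y ++ W'.map (shf a), by simp [hYl, hW'l], ?_, ?_⟩
    · refine ⟨s, t ++ W'.map (shf a), by simp [hst], hs, PW_append ht (PW_shf hW')⟩
    · refine ⟨fun i => if h : 1 ≤ i ∧ i - 1 < K + 1 then q ⟨i - 1, h.2⟩ else χ s, ?_⟩
      intro i hi u hu hua
      cases i with
      | zero =>
        have hu0 : u = [] := List.length_eq_zero_iff.1 hu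
        subst hu0
        have h1 : ((Y ++ W'.map (shf a)).takeWhile (· < a + 0)) = s := by
          rw [hst, List.append_assoc, List.takeWhile_append_of_pos (by simpa using hs)]
          simp
        rw [h1]
        have : s.map (sbt a []) = s := by
          conv_rhs => rw [← List.map_id s]
          exact List.map_congr_left (fun x hx => by simp [sbt_lt (hs x hx)])
        simp [this]
      | succ i =>
        cases u with
        | nil => simp at hu
        | cons e u' =>
        have h1 : ((Y ++ W'.map (shf a)).takeWhile (· < a + (i + 1))) =
            Y ++ (W'.takeWhile (· < a + i)).map (shf a) := by
          rw [List.takeWhile_append_of_pos (by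
            intro x hx; have := hYa x hx; simp; omega), List.takeWhile_map]
          congr 3
          funext x
          have : shf a x < a + (i + 1) ↔ x < a + i := by
            simp only [shf]
            split <;> omega
          simp [this]
        have he : e < a := hua e (by simp)
        have h2 : Y.map (sbt a (e :: u')) = Y.map (sbt a [e]) := by
          apply List.map_congr_left
          intro x hx
          have := hYa x hx
          by_cases hxa : x < a
          · simp [sbt, hxa]
          · have : x = a := by omega
            simp [sbt, this]
        have h3 : ((W'.takeWhile (· < a + i)).map (shf a)).map (sbt a (e :: u')) =
            (W'.takeWhile (· < a + i)).map (sbt a u') := by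
          rw [List.map_map]
          exact List.map_congr_left (fun x _ => sbt_shf a e u' x)
        rw [h1, List.map_append, h2, h3]
        have hP : (Y.map (sbt a [e])).length = L ∧ ∀ x ∈ Y.map (sbt a [e]), x < a := by
          refine ⟨by simp [hYl], ?_⟩
          intro x hx
          obtain ⟨y, hy, rfl⟩ := List.mem_map.1 hx
          have := hYa y hy
          by_cases hya : y < a
          · simp [sbt, hya]
          · have : y = a := by omega
            simp [sbt, this, he]
        have h4 := congrFun (hcol' i (by omega) u' (by simpa using hu)
          (fun x hx => hua x (by simp [hx]))) ⟨_, hP⟩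
        have h5 := congrFun (hq e he) ⟨i, by omega⟩
        simp only [dif_pos hP] at h5
        simp only at h4
        rw [h4, h5]
        simp only
        rw [dif_pos (show 1 ≤ i + 1 ∧ i + 1 - 1 < K + 1 from ⟨by omega, by omega⟩)]
        simp

/-- Graham Rothschild property -/
def GR (D : ℕ) : Prop := ∀ a : ℕ, 1 ≤ a → ∀ M : ℕ, ∀ (κ : Type) [Finite κ], ∃ N : ℕ,
  ∀ c : List ℕ → κ, ∃ W : List ℕ, W.length = N ∧ PW a M W ∧ ∃ q, ∀ w : List ℕ, w.length = M →
    PW a D w → c (W.map (sbt a w)) = q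

theorem GR_zero : GR 0 := by
  intro a _ M κ _
  obtain ⟨N, hN⟩ := CS a M κ
  refine ⟨N, fun c => ?_⟩
  obtain ⟨W, h1, h2, col, hcol⟩ := hN c
  refine ⟨W, h1, h2, col M, fun w hw hw' => ?_⟩
  rw [← hcol M le_rfl w hw hw']
  congr 2
  rw [eq_comm, List.takeWhile_eq_self_iff]
  intro x hx
  simpa using PW_lt h2 x hx

theorem stage1 {D : ℕ} (hD : GR D) (a : ℕ) (ha : 1 ≤ a) (K : ℕ) : ∀ (κ : Type) [Finite κ],
    ∃ N : ℕ, ∀ c : List ℕ → κ, ∃ W : List ℕ, W.length = N ∧ PW a K W ∧ ∃ χ : List ℕ → κ,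
      ∀ u v : List ℕ, u.length + 1 + v.length = K → (∀ x ∈ u, x < a) → PW (a + 1) D v →
        c (W.map (sbt a (u ++ a :: v))) = χ u := by
  induction K with
  | zero =>
    intro κ _
    refine ⟨0, fun c => ⟨[], rfl, by simp [PW], fun _ => c [], ?_⟩⟩
    intros; simp
  | succ K ih =>
    intro κ _
    obtain ⟨N1, h1⟩ := ih (Fin a → κ)
    obtain ⟨N2, h2⟩ := hD (a + 1) (by omega) N1 κ
    refine ⟨1 + N2, fun c => ?_⟩
    obtain ⟨V, hVl, hV, q, hq⟩ := h2 (fun y => c (a :: y))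
    obtain ⟨W', hWl, hW', χ', hχ'⟩ := h1 (fun y e => c (e.1 :: V.map (sbt a (e.1 :: y))))
    have hsl : (W'.map (shf a)).length = N1 := by simp [hWl]
    refine ⟨a :: V.map (sbt (a + 1) (W'.map (shf a))), by simp [hVl]; omega,
      ⟨[], _, rfl, by simp, PW_sbt hsl (PW_shf hW') hV⟩,
      fun u => match u with
        | [] => q
        | e :: u' => if h : e < a then χ' u' ⟨e, h⟩ else q, ?_⟩
    intro u v huv hu hv
    have gen : ∀ e y, (V.map (sbt (a + 1) (W'.map (shf a)))).map (sbt a (e :: y)) =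
        V.map (sbt a (e :: W'.map (sbt a y))) := by
      intro e y
      rw [List.map_map]
      apply List.map_congr_left
      intro x hx
      have hxl := PW_lt hV x hx
      simp only [Function.comp]
      by_cases hxa : x < a
      · simp [sbt, hxa, show x < a + 1 by omega]
      · by_cases hxa' : x = a
        · simp [sbt, hxa']
        · obtain ⟨j, rfl⟩ := Nat.exists_eq_add_of_le (show a + 1 ≤ x by omega)
          have hj : j < W'.length := by omega
          rw [sbt_add (by simpa using hj), List.getElem_map, sbt_shf,
            show a + 1 + j = a + (j + 1) by omega, sbt_add (by simpa using hj)]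
          simp
    cases u with
    | nil =>
      have h0 : sbt a (a :: v) a = a := by simp [sbt]
      simp only [List.nil_append, List.map_cons, h0]
      rw [← hq ((W'.map (shf a)).map (sbt (a + 1) v)) (by simp [hWl])
        (PW_sbt (M := K) (by simp at huv; omega) hv (PW_shf hW'))]
      congr 2
      rw [← sbt_assoc hV hsl, List.map_map, List.map_map]
      apply List.map_congr_left
      intro x hx
      simp only [Function.comp]
      generalize sbt (a + 1) (W'.map (shf a)) x = y
      simp only [sbt]
      rcases lt_trichotomy y a with h | h | h
      · simp [h, show y < a + 1 by omega]
      · simp [h]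
      · simp [show ¬ y < a by omega, show ¬ y < a + 1 by omega,
          show y - a = (y - (a + 1)) + 1 by omega]
    | cons e u' =>
      have he : e < a := hu e (by simp)
      have h0 : sbt a (e :: (u' ++ a :: v)) a = e := by simp [sbt]
      simp only [List.cons_append, List.map_cons, h0, dif_pos he]
      rw [gen]
      have := congrFun (hχ' u' v (by simp at huv; omega) (fun x hx => hu x (by simp [hx])) hv)
        ⟨e, he⟩
      simpa using this

/-- merging word -/
def bQ : (ℕ → Bool) → ℕ → ℕ → List ℕ
  | _, _, 0 => []
  | good, a, K + 1 =>
    if good 0 then a :: bQ (fun i => good (i + 1)) (a + 1) K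
      else 0 :: bQ (fun i => good (i + 1)) a K

theorem bQ_spec (K : ℕ) : ∀ (good : ℕ → Bool) (a : ℕ), 1 ≤ a → (bQ good a K).length = K ∧
    PW a (Nat.count (fun i => good i = true) K) (bQ good a K) := by
  induction K with
  | zero => intro good a _; simp [bQ, PW]
  | succ K ih =>
    intro good a ha
    rw [Nat.count_succ', bQ]
    split
    · rename_i h
      obtain ⟨h1, h2⟩ := ih (fun i => good (i + 1)) (a + 1) (by omega)
      refine ⟨by simp [h1], [], _, rfl, by simp, h2⟩
    · obtain ⟨h1, h2⟩ := ih (fun i => good (i + 1)) a ha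
      exact ⟨by simp [h1], PW_append (u := [0]) (by simp; omega) h2⟩

theorem bQ_good (K : ℕ) {D : ℕ} : ∀ (good : ℕ → Bool) (a a' : ℕ) (σ : ℕ → ℕ) (w : List ℕ), 1 ≤ a →
    (∀ x < a, σ x < a') → w.length = Nat.count (fun i => good i = true) K →
    (∀ j (h : j < w.length), σ (a + j) = w[j]) → PW a' (D + 1) w →
    ∃ u v, (bQ good a K).map σ = u ++ a' :: v ∧ (∀ x ∈ u, x < a') ∧ PW (a' + 1) D v ∧
      good u.length := by
  induction K with
  | zero =>
    rintro good a a' σ w _ _ hw _ ⟨u, v, rfl, _⟩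
    simp at hw
  | succ K ih =>
    intro good a a' σ w ha hσ hw hwσ hP
    rw [Nat.count_succ'] at hw
    rw [bQ]
    split
    · rename_i h
      rw [if_pos h] at hw
      cases w with
      | nil => simp at hw
      | cons w0 w' =>
      have h0 : σ a = w0 := hwσ 0 (by simp)
      have hw' : w'.length = Nat.count (fun i => good (i + 1) = true) K := by simpa using hw
      have h3' : ∀ j (h : j < w'.length), σ (a + 1 + j) = w'[j] := by
        intro j h
        have := hwσ (j + 1) (by simpa using h)
        rw [show a + 1 + j = a + (j + 1) by omega, this]
        simp
      obtain ⟨u, v, huv, hu, hv⟩ := hP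
      cases u with
      | nil =>
        simp only [List.nil_append, List.cons.injEq] at huv
        obtain ⟨rfl, rfl⟩ := huv
        refine ⟨[], _, by simp [h0]; rfl, by simp, ?_, by simpa using h⟩
        refine PW_comp ?_ hw' h3' hv (bQ_spec K _ (a + 1) (by omega)).2
        intro x hx
        rcases Nat.lt_succ_iff_lt_or_eq.1 hx with h | h
        · have := hσ x h; omega
        · subst h; omega
      | cons u0 u' =>
        simp only [List.cons_append, List.cons.injEq] at huv
        obtain ⟨rfl, rfl⟩ := huv
        have hw0 : w0 < a' := hu w0 (by simp)
        obtain ⟨u2, v2, e1, e2, e3, e4⟩ := ih (fun i => good (i + 1)) (a + 1) a' σ _ (by omega) (by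
          intro x hx
          rcases Nat.lt_succ_iff_lt_or_eq.1 hx with h | h
          · exact hσ x h
          · subst h; omega) hw' h3' ⟨u', v, rfl, fun x hx => hu x (by simp [hx]), hv⟩
        refine ⟨w0 :: u2, v2, by simp [e1, h0], ?_, e3, by simpa using e4⟩
        intro x hx
        rcases List.mem_cons.1 hx with rfl | h
        · exact hw0
        · exact e2 x h
    · rename_i h
      rw [if_neg h] at hw
      obtain ⟨u2, v2, e1, e2, e3, e4⟩ := ih (fun i => good (i + 1)) a a' σ w ha hσ
        (by simpa using hw) hwσ hP
      refine ⟨σ 0 :: u2, v2, by simp [e1], ?_, e3, by simpa using e4⟩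
      intro x hx
      rcases List.mem_cons.1 hx with rfl | h
      · exact hσ 0 (by omega)
      · exact e2 x h

theorem pigeon (κ : Type) [Finite κ] (M : ℕ) : ∃ K : ℕ, ∀ col : ℕ → κ, ∃ q : κ,
    ∃ S : Finset ℕ, S ⊆ Finset.range K ∧ S.card = M ∧ ∀ i ∈ S, col i = q := by
  classical
  have := Fintype.ofFinite κ
  refine ⟨Fintype.card κ * M + 1, fun col => ?_⟩
  obtain ⟨q, -, hq⟩ := Finset.exists_lt_card_fiber_of_mul_lt_card_of_maps_to
    (s := Finset.range (Fintype.card κ * M + 1)) (t := (Finset.univ : Finset κ)) (f := col) (n := M)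
    (by simp) (by simp)
  obtain ⟨S, hS, hSc⟩ := Finset.exists_subset_card_eq hq.le
  refine ⟨q, S, fun x hx => (Finset.mem_filter.1 (hS hx)).1, hSc,
    fun x hx => (Finset.mem_filter.1 (hS hx)).2⟩

theorem GR_succ {D : ℕ} (hD : GR D) : GR (D + 1) := by
  classical
  intro a ha M κ _
  obtain ⟨K, hK⟩ := pigeon κ M
  obtain ⟨K2, hK2⟩ := CS a K κ
  obtain ⟨N, hN⟩ := stage1 hD a ha K2 κ
  refine ⟨N, fun c => ?_⟩
  obtain ⟨W, hWl, hW, χ, hχ⟩ := hN c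
  obtain ⟨Z, hZl, hZ, col, hcol⟩ := hK2 χ
  obtain ⟨q, S, hSK, hSM, hS⟩ := hK col
  have hcount : Nat.count (fun i => decide (i ∈ S) = true) K = M := by
    rw [Nat.count_eq_card_filter_range, ← hSM]
    congr 1
    ext x
    simp only [Finset.mem_filter, decide_eq_true_eq]
    exact ⟨fun h => h.2, fun h => ⟨hSK h, h⟩⟩
  obtain ⟨hQl, hQ⟩ := bQ_spec K (fun i => decide (i ∈ S)) a ha
  rw [hcount] at hQ
  set Q := bQ (fun i => decide (i ∈ S)) a K with hQdef
  have hZQ : PW a M (Z.map (sbt a Q)) := PW_sbt hQl hQ hZ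
  refine ⟨W.map (sbt a (Z.map (sbt a Q))), by simp [hWl], PW_sbt (by simp [hZl]) hZQ hW, q, ?_⟩
  intro w hw hwP
  rw [sbt_assoc hW (by simp [hZl]), sbt_assoc hZ hQl]
  obtain ⟨u, v, e1, e2, e3, e4⟩ := bQ_good K (fun i => decide (i ∈ S)) a a (sbt a w) w ha
    (fun x hx => by rwa [sbt_lt hx]) (by rw [hcount, hw]) (fun j h => sbt_add h) hwP
  rw [← hQdef] at e1
  rw [decide_eq_true_eq] at e4
  rw [e1]
  have huK : u.length < K := by simpa using hSK e4
  have hl : u.length + (v.length + 1) = K := by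
    have := congrArg List.length e1
    simp [hQl] at this
    omega
  obtain ⟨P, R, hZs, hP, hR⟩ := PW_split hZ u.length huK
  have f1 : Z.takeWhile (· < a + u.length) = P := by
    rw [hZs, List.takeWhile_append_of_pos (by simpa using hP)]
    simp
  have f2 := hcol u.length huK.le u rfl e2
  rw [f1] at f2
  have f3 : Z.map (sbt a (u ++ a :: v)) =
      P.map (sbt a u) ++ a :: R.map (sbt a (u ++ a :: v)) := by
    rw [hZs, List.map_append, List.map_cons, sbt_add (by simp)]
    congr 1
    · apply List.map_congr_left
      intro x hx
      have := hP x hx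
      by_cases hxa : x < a
      · simp [sbt, hxa]
      · have h' : x - a < u.length := by omega
        simp [sbt, hxa, h', List.getElem?_append_left h']
    · simp
  have f4 : ∀ x < a + u.length, sbt a (u ++ a :: v) x < a := by
    intro x hx
    by_cases hxa : x < a
    · simp [sbt, hxa]
    · obtain ⟨j, rfl⟩ := Nat.exists_eq_add_of_le (not_lt.1 hxa)
      have hj : j < u.length := by omega
      rw [sbt_add (by simp; omega), List.getElem_append_left hj]
      exact e2 _ (List.getElem_mem _)
  rw [f3, hχ, f2, hS _ e4]
  · have := congrArg List.length hZs
    simp [hZl] at this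
    simp; omega
  · intro x hx
    obtain ⟨y, hy, rfl⟩ := List.mem_map.1 hx
    have hyP := hP y hy
    by_cases hxa : y < a
    · simp [sbt, hxa]
    · obtain ⟨j, rfl⟩ := Nat.exists_eq_add_of_le (not_lt.1 hxa)
      rw [sbt_add (by omega)]
      exact e2 _ (List.getElem_mem _)
  · refine PW_comp (w := v) ?_ (by omega) ?_ e3 hR
    · intro x hx
      rcases Nat.lt_succ_iff_lt_or_eq.1 hx with h | h
      · have := f4 x h; omega
      · subst h
        rw [sbt_add (by simp)]
        simp
    · intro j hj
      rw [show a + u.length + 1 + j = a + (u.length + (j + 1)) by omega, sbt_add (by simp; omega)]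
      rw [List.getElem_append_right (by omega)]
      simp

theorem GR_all (D : ℕ) : GR D := by
  induction D with
  | zero => exact GR_zero
  | succ D ih => exact GR_succ ih

/-- decoding a letter -/
def dcv (k t i : ℕ) : ℕ := if i * k < t ∧ t ≤ i * k + k then t - i * k else 0

/-- decoding a word -/
def dcw (k : ℕ) (w : List ℕ) (i x : ℕ) : ℕ := if x = 0 then 0 else dcv k (w.getD (x - 1) 0) i

theorem dcv_zero (k i : ℕ) : dcv k 0 i = 0 := by simp [dcv]

theorem dcv_disj {k t i j : ℕ} (hij : i ≠ j) : dcv k t i = 0 ∨ dcv k t j = 0 := by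
  have key : ∀ i j, i < j → i * k + k ≤ j * k := by
    intro i j h
    calc i * k + k = (i + 1) * k := by ring
      _ ≤ j * k := Nat.mul_le_mul_right _ h
  unfold dcv
  rcases lt_or_gt_of_ne hij with h | h
  · have := key i j h
    by_cases h1 : i * k < t ∧ t ≤ i * k + k
    · right; rw [if_neg]; omega
    · left; rw [if_neg h1]
  · have := key j i h
    by_cases h1 : i * k < t ∧ t ≤ i * k + k
    · right; rw [if_neg]; omega
    · left; rw [if_neg h1]

theorem tet_fun (k : ℕ) : ∀ v : Fin k → ℕ, ∃ g : ℕ → ℕ, g 0 = 0 ∧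
    (∀ y, g y ≤ g (y + 1) ∧ g (y + 1) ≤ g y + 1) ∧ ∀ p x, TetComp k v p x = g (p x) := by
  induction k with
  | zero => intro v; exact ⟨id, rfl, by simp, fun p x => rfl⟩
  | succ k ih =>
    intro v
    obtain ⟨g, h0, h1, h2⟩ := ih (fun j => v j.succ)
    refine ⟨fun y => if 0 < v 0 ∧ v 0 ≤ g y then g y - 1 else g y, by simp [h0], ?_, ?_⟩
    · intro y
      have := h1 y
      simp only
      split_ifs <;> omega
    · intro p x
      simp only [TetComp, Tet, h2]

theorem ivt {g : ℕ → ℕ} (h0 : g 0 = 0) (h1 : ∀ y, g (y + 1) ≤ g y + 1) {v : ℕ} :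
    ∀ j, v + 1 ≤ g j → ∃ j' < j, g j' = v := by
  intro j
  induction j with
  | zero => intro h; omega
  | succ j ih =>
    intro h
    have := h1 j
    by_cases hv : g j = v
    · exact ⟨j, by omega, hv⟩
    · obtain ⟨j', a, b⟩ := ih (by omega)
      exact ⟨j', by omega, b⟩

theorem sum_dcv {m l t : ℕ} (g : Fin m → ℕ → ℕ) (h0 : ∀ s, g s 0 = 0) (s : Fin m)
    (hs : dcv l t s ≠ 0) : ∑ s' : Fin m, g s' (dcv l t s') = g s (dcv l t s) := by
  apply Finset.sum_eq_single s
  · intro s' _ hne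
    rcases dcv_disj (k := l) (t := t) (i := s) (j := s') (fun h => hne (Fin.ext h.symm)) with h | h
    · exact absurd h hs
    · rw [h, h0]
  · intro h; exact absurd (Finset.mem_univ _) h

theorem sum_ivt {m l : ℕ} (g : Fin m → ℕ → ℕ) (h0 : ∀ s, g s 0 = 0)
    (h1 : ∀ s y, g s (y + 1) ≤ g s y + 1) {t v : ℕ} (hv : 1 ≤ v)
    (ht : ∑ s : Fin m, g s (dcv l t s) = v + 1) :
    ∃ t' < t, ∑ s : Fin m, g s (dcv l t' s) = v := by
  have : ∃ s : Fin m, dcv l t s ≠ 0 := by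
    by_contra hcon
    push Not at hcon
    simp [hcon, h0] at ht
  obtain ⟨s, hs⟩ := this
  rw [sum_dcv g h0 s hs] at ht
  obtain ⟨j', hj', hgj⟩ := ivt (h0 s) (h1 s) (dcv l t s) ht.ge
  have hj0 : j' ≠ 0 := by rintro rfl; rw [h0] at hgj; omega
  have hd : dcv l t s = t - s * l ∧ s * l < t ∧ t ≤ s * l + l := by
    unfold dcv at hs ⊢
    split_ifs at hs ⊢ with h
    · exact ⟨rfl, h⟩
    · simp at hs
  have hd' : dcv l (s * l + j') s = j' := by
    unfold dcv
    rw [if_pos (by omega)]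
    omega
  refine ⟨s * l + j', by omega, ?_⟩
  rw [sum_dcv g h0 s (by rw [hd']; exact hj0), hd', hgj]

/-- position of the first occurrence of a letter -/
theorem PW_pos {M : ℕ} {W : List ℕ} (h : PW 1 M W) {t : ℕ} (h1 : 1 ≤ t) (h2 : t ≤ M) :
    ∃ x, x < W.length ∧ W.getD x 0 = t ∧ ∀ y < x, W.getD y 0 < t := by
  obtain ⟨P, R, rfl, hP, -⟩ := PW_split h (t - 1) (by omega)
  refine ⟨P.length, by simp, by simp; omega, ?_⟩
  intro y hy
  have := hP _ (List.getElem_mem hy)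
  simp only [List.getD_eq_getElem?_getD, List.getElem?_append_left hy]
  simp [hy]
  omega

theorem blk {i m l : ℕ} (h : i < m) : i * l + l ≤ m * l := by
  calc i * l + l = (i + 1) * l := by ring
    _ ≤ m * l := Nat.mul_le_mul_right _ h

theorem star_of_PW {m l : ℕ} (hl : 1 ≤ l) {W : List ℕ} (h : PW 1 (m * l) W) :
    memFINstar l m W.length (fun s x => dcw l W s x) := by
  refine ⟨?_, ?_, ?_⟩
  · intro s
    refine ⟨?_, ?_, ?_⟩
    · intro x
      simp only [dcw, dcv]
      split_ifs <;> omega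
    · intro x hx
      simp only [dcw] at hx
      by_cases h0 : x = 0
      · simp [h0] at hx
      · rw [if_neg h0] at hx
        by_contra hcon
        apply hx
        rw [List.getD_eq_default _ _ (by omega), dcv_zero]
    · have hb := blk (l := l) s.2
      obtain ⟨x, -, hx, -⟩ := PW_pos h (t := s * l + l) (by omega) hb
      refine ⟨x + 1, ?_⟩
      simp only [dcw, Nat.add_sub_cancel, hx, dcv]
      simp; omega
  · intro i j hij x
    simp only [dcw]
    split_ifs
    · simp
    · exact dcv_disj (fun h => hij (Fin.ext h))
  · intro i hi
    have hb := blk (l := l) i.2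
    have hb' := blk (l := l) hi
    have e : (i.val + 1) * l = i.val * l + l := by ring
    obtain ⟨x, -, hx, hxy⟩ := PW_pos h (t := i * l + l) (by omega) hb
    have hne : {x | dcw l W (i.val + 1) x ≠ 0}.Nonempty := by
      obtain ⟨x, -, hx, -⟩ := PW_pos h (t := (i.val + 1) * l + l) (by omega) hb'
      refine ⟨x + 1, ?_⟩
      simp only [Set.mem_ofPred_eq, dcw, Nat.add_sub_cancel, hx, dcv]
      simp; omega
    have hmem := Nat.sInf_mem hne
    have h1 : sInf {x | dcw l W i x = l} ≤ x + 1 := by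
      apply Nat.sInf_le
      simp only [Set.mem_ofPred_eq, dcw, Nat.add_sub_cancel, hx, dcv]
      simp; omega
    refine lt_of_le_of_lt h1 ?_
    change x + 1 < sInf {x | dcw l W (i.val + 1) x ≠ 0}
    generalize sInf {x | dcw l W (i.val + 1) x ≠ 0} = y at hmem
    simp only [Set.mem_ofPred_eq, dcw] at hmem
    have hy0 : y ≠ 0 := by rintro rfl; simp at hmem
    rw [if_neg hy0] at hmem
    have ht : i * l + l < W.getD (y - 1) 0 := by
      unfold dcv at hmem
      split_ifs at hmem with hc
      · omega
      · simp at hmem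
    by_contra hcon
    rcases Nat.lt_or_ge (y - 1) x with hlt | hge
    · have := hxy _ hlt; omega
    · have : y - 1 = x := by omega
      rw [this] at ht; omega

theorem code_exists {k d m l n : ℕ} (hk : 1 ≤ k) (hd : 1 ≤ d) {W : List ℕ}
    (hW : PW 1 (m * l) W) (hn : W.length = n) {p : Fin d → ℕ → ℕ} (hp : memFINstar k d n p)
    (hS : ∀ i, memSG k l m (fun s x => dcw l W s x) (p i)) :
    ∃ w : List ℕ, w.length = m * l ∧ PW 1 (d * k) w ∧
      (fun (i : Fin d) x => dcw k (W.map (sbt 1 w)) i x) = p := by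
  subst hn
  obtain ⟨hp1, hp2, hp3⟩ := hp
  have : ∀ i, ∃ g : Fin m → ℕ → ℕ, (∀ s, g s 0 = 0) ∧ (∀ s y, g s (y + 1) ≤ g s y + 1) ∧
      ∀ x, p i x = ∑ s, g s (dcw l W s x) := by
    intro i
    obtain ⟨iv, tv, -, -, -, hq⟩ := hS i
    choose g1 a1 a2 a3 using fun s => tet_fun (l - k) (iv s)
    choose g2 b1 b2 b3 using fun s => tet_fun k (tv s)
    refine ⟨fun s y => g2 s (g1 s y), fun s => by simp [a1, b1], ?_, ?_⟩
    · intro s y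
      have e := a2 s y
      rcases (show g1 s (y + 1) = g1 s y ∨ g1 s (y + 1) = g1 s y + 1 by omega) with h | h
      · simp only [h]; omega
      · simp only [h]; exact (b2 s _).2
    · intro x
      rw [hq]
      simp only [a3, b3]
  choose g g0 g1 gp using this
  let h : Fin d → ℕ → ℕ := fun i t => ∑ s, g i s (dcv l t s)
  have h0 : ∀ i, h i 0 = 0 := by intro i; simp [h, dcv_zero, g0]
  have hpx : ∀ i x, p i (x + 1) = h i (W.getD x 0) := by
    intro i x; rw [gp]; simp [h, dcw]
  have hp0 : ∀ i, p i 0 = 0 := by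
    intro i; rw [gp]; simp [dcw, g0]
  have hle : ∀ t ≤ m * l, ∀ i, h i t ≤ k := by
    intro t ht i
    by_cases ht0 : t = 0
    · rw [ht0, h0]; omega
    · obtain ⟨x, -, hx, -⟩ := PW_pos hW (show 1 ≤ t by omega) ht
      rw [← hx, ← hpx]; exact (hp1 i).1 _
  have hdis : ∀ t ≤ m * l, ∀ i j, i ≠ j → h i t = 0 ∨ h j t = 0 := by
    intro t ht i j hij
    by_cases ht0 : t = 0
    · left; rw [ht0, h0]
    · obtain ⟨x, -, hx, -⟩ := PW_pos hW (show 1 ≤ t by omega) ht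
      rw [← hx, ← hpx, ← hpx]; exact hp2 i j hij _
  have hWle : ∀ x, W.getD x 0 ≤ m * l := by
    intro x
    by_cases hx : x < W.length
    · have := PW_lt hW _ (List.getElem_mem hx)
      simp [hx]; omega
    · rw [List.getD_eq_default _ _ (by omega)]; omega
  let H : ℕ → ℕ := fun t => ∑ i : Fin d, if h i t = 0 then 0 else i * k + h i t
  have H1 : ∀ t ≤ m * l, ∀ i, h i t ≠ 0 → H t = i * k + h i t := by
    intro t ht i hi
    have : H t = if h i t = 0 then 0 else i * k + h i t := by
      apply Finset.sum_eq_single i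
      · intro j _ hj
        rcases hdis t ht i j hj.symm with e | e
        · exact absurd e hi
        · simp [e]
      · intro e; exact absurd (Finset.mem_univ _) e
    rw [this, if_neg hi]
  have H0 : ∀ t, (∀ i, h i t = 0) → H t = 0 := by
    intro t ht
    simp [H, ht]
  have Hinv : ∀ t, H t ≠ 0 → ∃ i, h i t ≠ 0 := by
    intro t ht
    by_contra hcon
    push Not at hcon
    exact ht (H0 t hcon)
  refine ⟨(List.range (m * l)).map (fun z => H (z + 1)), by simp, ?_, ?_⟩
  · apply PW_of
    · intro x hx
      obtain ⟨z, hz, rfl⟩ := List.mem_map.1 hx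
      have hz' : z + 1 ≤ m * l := by simpa using hz
      by_cases hH : H (z + 1) = 0
      · simp only [hH]; omega
      · obtain ⟨i, hi⟩ := Hinv _ hH
        rw [H1 _ hz' i hi]
        have := hle _ hz' i
        have := blk (l := k) i.2
        omega
    · intro _
      have hd1 : d - 1 < d := by omega
      obtain ⟨x, hx⟩ := (hp1 ⟨d - 1, hd1⟩).2.2
      cases x with
      | zero => rw [hp0] at hx; omega
      | succ x =>
      rw [hpx] at hx
      have ht := hWle x
      have ht0 : W.getD x 0 ≠ 0 := by
        intro e; rw [e, h0] at hx; omega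
      refine List.mem_map.2 ⟨W.getD x 0 - 1, by simp only [List.mem_range]; omega, ?_⟩
      rw [show W.getD x 0 - 1 + 1 = W.getD x 0 by omega, H1 _ ht _ (by rw [hx]; omega), hx]
      simp only
      have : d * k = (d - 1) * k + k := by
        obtain ⟨e, rfl⟩ := Nat.exists_eq_add_of_le hd
        rw [Nat.add_sub_cancel_left]; ring
      omega
    · intro z t hz
      have hzl : z < m * l := by
        have := (List.getElem?_eq_some_iff.1 hz).1
        simpa using this
      have hz' : H (z + 1) = 1 + t + 1 := by
        simpa [List.getElem?_range hzl] using hz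
      suffices hh : ∃ t', t' < z + 1 ∧ H t' = 1 + t by
        obtain ⟨t', a, b⟩ := hh
        have ht0 : t' ≠ 0 := by
          rintro rfl
          rw [H0 0 h0] at b; omega
        refine ⟨t' - 1, by omega, ?_⟩
        rw [List.getElem?_map, List.getElem?_range (by omega)]
        simp only [Option.map_some]
        rw [show t' - 1 + 1 = t' by omega, b]
      obtain ⟨i, hi⟩ := Hinv (z + 1) (by omega)
      have e1 := H1 (z + 1) hzl i hi
      by_cases hv : h i (z + 1) = 1
      · have hi0 : i.val ≠ 0 := by
          intro e; rw [e, hv, zero_mul] at e1; omega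
        let i' : Fin d := ⟨i.val - 1, by omega⟩
        have h3 := hp3 i' (by simp only [i']; omega)
        have ei : (⟨i'.val + 1, by simp only [i']; omega⟩ : Fin d) = i :=
          Fin.ext (by simp only [i']; omega)
        rw [ei] at h3
        obtain ⟨x, -, hx, hxy⟩ := PW_pos hW (show 1 ≤ z + 1 by omega) hzl
        have h4 : sInf {x | p i x ≠ 0} ≤ x + 1 := by
          apply Nat.sInf_le
          simp only [Set.mem_ofPred_eq]
          rw [hpx, hx]; exact hi
        have h5 := Nat.sInf_mem (s := {x | p i' x = k}) (hp1 i').2.2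
        generalize sInf {x | p i' x = k} = y at h3 h5
        simp only [Set.mem_ofPred_eq] at h5
        cases y with
        | zero => rw [hp0] at h5; omega
        | succ y =>
        rw [hpx] at h5
        refine ⟨W.getD y 0, hxy y (by omega), ?_⟩
        rw [H1 _ (hWle y) i' (by omega), h5]
        have : i.val * k = i'.val * k + k := by
          have : i.val = i'.val + 1 := by simp only [i']; omega
          rw [this]; ring
        omega
      · obtain ⟨t', ht', e⟩ := sum_ivt (l := l) (g i) (g0 i) (g1 i) (t := z + 1)
          (v := h i (z + 1) - 1) (by omega) (by change h i (z + 1) = _; omega)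
        change h i t' = _ at e
        refine ⟨t', ht', ?_⟩
        rw [H1 t' (by omega) i (by omega), e]
        omega
  · have hmap : W.map (sbt 1 ((List.range (m * l)).map (fun z => H (z + 1)))) = W.map H := by
      apply List.map_congr_left
      intro x hx
      have := PW_lt hW x hx
      by_cases hx0 : x = 0
      · subst hx0
        rw [H0 0 h0]; simp [sbt]
      · obtain ⟨j, rfl⟩ := Nat.exists_eq_add_of_le (show 1 ≤ x by omega)
        rw [sbt_add (by simp; omega)]
        simp [add_comm]
    rw [hmap]
    funext i x
    cases x with
    | zero => simp [dcw, hp0]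
    | succ x =>
      have hg : (W.map H).getD x 0 = H (W.getD x 0) := by
        by_cases hx : x < W.length
        · simp [hx]
        · rw [List.getD_eq_default _ _ (by simpa using hx),
            List.getD_eq_default _ _ (by omega), H0 0 h0]
      simp only [dcw, Nat.add_sub_cancel, hg, hpx]
      have ht := hWle x
      generalize W.getD x 0 = t at ht
      simp only [Nat.add_eq_zero_iff, one_ne_zero, and_false, if_false]
      have dv : ∀ j : Fin d, h j t ≠ 0 → dcv k (H t) j = h j t := by
        intro j hj
        rw [H1 t ht j hj]
        have := hle t ht j
        unfold dcv
        rw [if_pos (by omega)]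
        omega
      by_cases hi : h i t = 0
      · rw [hi]
        by_cases hH : H t = 0
        · rw [hH, dcv_zero]
        · obtain ⟨j, hj⟩ := Hinv t hH
          have hij : j.val ≠ i.val := by
            intro e
            have := Fin.ext e
            subst this
            exact hj hi
          rcases dcv_disj (k := k) (t := H t) hij with e | e
          · rw [dv j hj] at e; exact absurd e hj
          · exact e
      · exact dv i hi

/-- for `k ≥ 1`, `m ≥ d ≥ 1`, `l ≥ k`, `r ≥ 2`, there is `n` such that for
every `r`-colouring of `FIN_k^{*(d)}(n)` there is `B ∈ FIN_l^{*(m)}(n)` such that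
`⟨⋃_{ī ∈ P_{k+1}^l} T_ī(B)⟩_{P_k}^{*(d)}` is monochromatic. -/
theorem stmt_10 (k : ℕ) (hk : 1 ≤ k) (d m : ℕ) (hd : 1 ≤ d) (hdm : d ≤ m)
    (l : ℕ) (hkl : k ≤ l) (r : ℕ) (hr : 2 ≤ r) :
    ∃ n : ℕ, ∀ c : (Fin d → ℕ → ℕ) → Fin r,
      ∃ b : Fin m → ℕ → ℕ, memFINstar l m n b ∧
        ∀ p q : Fin d → ℕ → ℕ,
          (memFINstar k d n p ∧ ∀ i, memSG k l m b (p i)) →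
          (memFINstar k d n q ∧ ∀ i, memSG k l m b (q i)) →
          c p = c q := by
  obtain ⟨N, hN⟩ := GR_all (d * k) 1 le_rfl (m * l) (Fin r)
  refine ⟨N, fun c => ?_⟩
  obtain ⟨W, hWl, hW, q0, hq0⟩ := hN (fun w => c (fun i x => dcw k w i x))
  refine ⟨fun s x => dcw l W s x, hWl ▸ star_of_PW (by omega) hW, ?_⟩
  rintro p q ⟨hp, hpS⟩ ⟨hq, hqS⟩
  obtain ⟨w, h1, h2, h3⟩ := code_exists hk hd hW hWl hp hpS
  obtain ⟨w', h1', h2', h3'⟩ := code_exists hk hd hW hWl hq hqS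
  have e := hq0 w h1 h2
  have e' := hq0 w' h1' h2'
  rw [h3] at e
  rw [h3'] at e'
  rw [e, e']
end

section
/- The class F_c is a Ramsey class: for every integer r ≥ 2 and all S, T ∈ F_c such that there exists at least one epimorphism in F_c from T onto S, there exists U ∈ F_c such that for every colouring e of the set of epimorphisms in F_c from U onto S with r colours there exists an epimorphism g in F_c from U onto T such that the set {h ∘ g : h an epimorphism in F_c from T onto S} is e-monochromatic. -/
/-- A finite fan: a finite poset with a least element (the root) such that the
set of predecessors of any element is linearly ordered, and the set of successors
of any non-root element is linearly ordered. -/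
structure FiniteFan where
  carrier : Type
  fintype : Fintype carrier
  ord : PartialOrder carrier
  root : carrier
  root_le : ∀ a : carrier, ord.le root a
  down_chain : ∀ a x y : carrier, ord.le x a → ord.le y a → ord.le x y ∨ ord.le y x
  up_chain : ∀ a : carrier, a ≠ root →
    ∀ x y : carrier, ord.le a x → ord.le a y → ord.le x y ∨ ord.le y x

attribute [instance] FiniteFan.fintype

/-- `t` is an immediate successor of `s` in the fan `A`. -/
def FiniteFan.covby (A : FiniteFan) (s t : A.carrier) : Prop :=
  A.ord.lt s t ∧ ∀ p : A.carrier, A.ord.lt s p → ¬ A.ord.lt p t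

/-- The relation `R^A` : `R^A(s,t)` iff `s = t` or `t` is an immediate successor of `s`. -/
def FiniteFan.R (A : FiniteFan) (s t : A.carrier) : Prop :=
  s = t ∨ A.covby s t

/-- An epimorphism of finite fans: a surjection with `R^B(s,t) → R^A(φ s, φ t)`. -/
def FanEpi (B A : FiniteFan) (φ : B.carrier → A.carrier) : Prop :=
  Function.Surjective φ ∧ ∀ s t : B.carrier, B.R s t → A.R (φ s) (φ t)

/-- A downwards closed subset of a finite fan. -/
def FiniteFan.DownClosed (A : FiniteFan) (C : Set A.carrier) : Prop :=
  ∀ x y : A.carrier, A.ord.le x y → y ∈ C → x ∈ C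

/-- A downwards closed maximal chain on a finite fan: a family of downwards closed
subsets linearly ordered by inclusion, maximal among such families. -/
def DCMaxChain (A : FiniteFan) (𝒞 : Set (Set A.carrier)) : Prop :=
  (∀ C ∈ 𝒞, A.DownClosed C) ∧ IsChain (· ⊆ ·) 𝒞 ∧
  ∀ C : Set A.carrier, A.DownClosed C → IsChain (· ⊆ ·) (insert C 𝒞) → C ∈ 𝒞

/-- An epimorphism in the class `F_c`: a fan epimorphism mapping the chain onto the chain. -/
def FcEpi (B A : FiniteFan) (𝒞B : Set (Set B.carrier)) (𝒞A : Set (Set A.carrier))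
    (φ : B.carrier → A.carrier) : Prop :=
  FanEpi B A φ ∧ (Set.image φ) '' 𝒞B = 𝒞A

/-- A branch of a fan: a maximal linearly ordered subset. -/
def FiniteFan.IsBranch (A : FiniteFan) (b : Set A.carrier) : Prop :=
  IsChain A.ord.le b ∧ ∀ b' : Set A.carrier, IsChain A.ord.le b' → b ⊆ b' → b' = b

/-- The height of a finite fan: the maximal `n` such that some branch has `n+1` elements. -/
noncomputable def FiniteFan.height (A : FiniteFan) : ℕ :=
  sSup {n : ℕ | ∃ b : Set A.carrier, A.IsBranch b ∧ b.ncard = n + 1}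

/-- The width of a finite fan: the number of its branches. -/
noncomputable def FiniteFan.width (A : FiniteFan) : ℕ :=
  {b : Set A.carrier | A.IsBranch b}.ncard

/-- A chain on a finite fan is canonical if there is an enumeration `b₁,…,bₙ` of the
branches such that whenever `C` is in the chain and `C ∩ b_j ≠ ∅`, then `b_i ⊆ C`
for all `i < j`. -/
def Canonical (A : FiniteFan) (𝒞 : Set (Set A.carrier)) : Prop :=
  ∃ (n : ℕ) (b : Fin n → Set A.carrier),
    (∀ i, A.IsBranch (b i)) ∧ Function.Injective b ∧
    (∀ b' : Set A.carrier, A.IsBranch b' → ∃ i, b' = b i) ∧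
    ∀ C ∈ 𝒞, ∀ i j : Fin n, i < j → (C ∩ b j).Nonempty → b i ⊆ C

/-- Membership in the class `F_cc`: a downwards closed maximal chain which is canonical,
on a fan all of whose branches have the same height. -/
def Fcc (A : FiniteFan) (𝒞 : Set (Set A.carrier)) : Prop :=
  DCMaxChain A 𝒞 ∧ Canonical A 𝒞 ∧ ∃ k : ℕ, ∀ b : Set A.carrier, A.IsBranch b → b.ncard = k + 1


/-- finite Ramsey -/
theorem fRamsey (κ : Type) [Finite κ] (d : ℕ) : ∀ D : ℕ, ∃ K : ℕ, ∀ c : Finset ℕ → κ, ∀ A : Finset ℕ,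
    K ≤ A.card → ∃ Q ⊆ A, Q.card = D ∧ ∀ P₁ P₂, P₁ ⊆ Q → P₂ ⊆ Q → P₁.card = d → P₂.card = d →
      c P₁ = c P₂ := by
  classical
  induction d with
  | zero =>
    intro D
    refine ⟨D, fun c A hA => ?_⟩
    obtain ⟨Q, hQ, hc⟩ := Finset.exists_subset_card_eq hA
    refine ⟨Q, hQ, hc, fun P₁ P₂ _ _ h1 h2 => ?_⟩
    rw [Finset.card_eq_zero] at h1 h2
    rw [h1, h2]
  | succ d ih =>
    -- end-homogeneous sets
    have key : ∀ n : ℕ, ∃ K : ℕ, ∀ c : Finset ℕ → κ, ∀ A : Finset ℕ, K ≤ A.card →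
        ∃ Q ⊆ A, Q.card = n ∧ ∃ k : ℕ → κ, ∀ a ∈ Q, ∀ P ⊆ Q, (∀ x ∈ P, a < x) → P.card = d →
          c (insert a P) = k a := by
      intro n
      induction n with
      | zero =>
        refine ⟨0, fun c A _ => ⟨∅, by simp, rfl, fun _ => c ∅, by simp⟩⟩
      | succ n ihn =>
        obtain ⟨K1, hK1⟩ := ihn
        obtain ⟨K2, hK2⟩ := ih K1
        refine ⟨K2 + 1, fun c A hA => ?_⟩
        have hne : A.Nonempty := by
          rw [← Finset.card_pos]; omega
        set a := A.min' hne with ha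
        have haA : a ∈ A := A.min'_mem hne
        have hcard : K2 ≤ (A.erase a).card := by
          rw [Finset.card_erase_of_mem haA]; omega
        obtain ⟨Q, hQ, hQc, hQh⟩ := hK2 (fun P => c (insert a P)) _ hcard
        obtain ⟨Q', hQ', hQc', k, hk⟩ := hK1 c Q hQc.ge
        have hlt : ∀ x ∈ Q', a < x := by
          intro x hx
          have := hQ (hQ' hx)
          rw [Finset.mem_erase] at this
          exact lt_of_le_of_ne (A.min'_le x this.2) (Ne.symm this.1)
        have haQ : a ∉ Q' := fun h => lt_irrefl _ (hlt a h)
        have hsub : ∀ P ⊆ insert a Q', (∀ x ∈ P, x ≠ a) → P ⊆ Q' := by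
          intro P hP h x hx
          have := hP hx
          rw [Finset.mem_insert] at this
          exact this.resolve_left (h x hx)
        refine ⟨insert a Q', ?_, ?_, ?_⟩
        · intro x hx
          rw [Finset.mem_insert] at hx
          rcases hx with rfl | hx
          · exact haA
          · exact Finset.mem_of_mem_erase (hQ (hQ' hx))
        · rw [Finset.card_insert_of_notMem haQ, hQc']
        · by_cases hex : ∃ P0 ⊆ Q', P0.card = d
          · obtain ⟨P0, hP0, hP0c⟩ := hex
            refine ⟨fun x => if x = a then c (insert a P0) else k x, ?_⟩
            intro b hb P hP hPb hPc
            rw [Finset.mem_insert] at hb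
            rcases hb with rfl | hb
            · simp only [if_true]
              exact hQh _ _ ((hsub P hP (fun x hx => (hPb x hx).ne')).trans hQ') (hP0.trans hQ') hPc hP0c
            · have hba := hlt b hb
              simp only [hba.ne', if_false]
              exact hk b hb P (hsub P hP (fun x hx => (hba.trans (hPb x hx)).ne')) hPb hPc
          · refine ⟨k, ?_⟩
            intro b hb P hP hPb hPc
            exfalso
            apply hex
            refine ⟨P, hsub P hP ?_, hPc⟩
            rw [Finset.mem_insert] at hb
            rcases hb with rfl | hb
            · exact fun x hx => (hPb x hx).ne'
            · exact fun x hx => ((hlt b hb).trans (hPb x hx)).ne'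
    intro D
    have := Fintype.ofFinite κ
    obtain ⟨K, hK⟩ := key (Fintype.card κ * D)
    refine ⟨K, fun c A hA => ?_⟩
    obtain ⟨Q, hQ, hQc, k, hk⟩ := hK c A hA
    have hκ : Nonempty κ := ⟨c ∅⟩
    obtain ⟨y, -, hy⟩ := Finset.exists_le_card_fiber_of_mul_le_card_of_maps_to
      (s := Q) (t := (Finset.univ : Finset κ)) (f := k) (n := D) (fun _ _ => Finset.mem_univ _)
      Finset.univ_nonempty (by rw [hQc]; rfl)
    obtain ⟨Q', hQ', hc'⟩ := Finset.exists_subset_card_eq hy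
    have hQ'Q : Q' ⊆ Q := hQ'.trans (Finset.filter_subset _ _)
    refine ⟨Q', hQ'Q.trans hQ, hc', ?_⟩
    have : ∀ P ⊆ Q', P.card = d + 1 → c P = y := by
      intro P hP hPc
      have hne : P.Nonempty := by rw [← Finset.card_pos]; omega
      have hm := P.min'_mem hne
      have h1 := hk (P.min' hne) (hQ'Q (hP hm)) (P.erase (P.min' hne))
        ((Finset.erase_subset _ _).trans (hP.trans hQ'Q))
        (fun x hx => lt_of_le_of_ne (P.min'_le x (Finset.mem_of_mem_erase hx))
          (Ne.symm (Finset.ne_of_mem_erase hx)))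
        (by rw [Finset.card_erase_of_mem hm]; omega)
      rw [Finset.insert_erase hm] at h1
      rw [h1]
      exact (Finset.mem_filter.1 (hQ' (hP hm))).2
    intro P1 P2 h1 h2 h3 h4
    rw [this P1 h1 h3, this P2 h2 h4]


/-- A parent function on ℕ. -/
def PTree (p : ℕ → ℕ) : Prop := p 0 = 0 ∧ ∀ i, 0 < i → p i < i

theorem PTree.le {p : ℕ → ℕ} (hp : PTree p) (i : ℕ) : p i ≤ i := by
  rcases Nat.eq_zero_or_pos i with rfl | h
  · rw [hp.1]
  · exact (hp.2 i h).le

theorem PTree.iter_zero {p : ℕ → ℕ} (hp : PTree p) (k : ℕ) : p^[k] 0 = 0 :=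
  Function.iterate_fixed hp.1 k

theorem PTree.iter_le {p : ℕ → ℕ} (hp : PTree p) (k i : ℕ) : p^[k] i ≤ i - k := by
  induction k with
  | zero => simp
  | succ k ih =>
    rw [Function.iterate_succ_apply']
    rcases Nat.eq_zero_or_pos (p^[k] i) with h | h
    · rw [h, hp.1]; omega
    · have := hp.2 _ h
      omega

theorem PTree.iter_eq_zero {p : ℕ → ℕ} (hp : PTree p) {k i : ℕ} (h : i ≤ k) : p^[k] i = 0 := by
  have := hp.iter_le k i
  omega

/-- number of elements of `P` that are at least `i` -/
def cntGe (P : Finset ℕ) (i : ℕ) : ℕ := (P.filter (fun j => i ≤ j)).card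

theorem cntGe_step (P : Finset ℕ) (i : ℕ) :
    cntGe P i = cntGe P (i+1) + (if i ∈ P then 1 else 0) := by
  classical
  unfold cntGe
  split_ifs with h
  · rw [← Finset.card_insert_of_notMem (a := i) (s := P.filter (fun j => i + 1 ≤ j)) (by simp)]
    congr 1
    ext x
    simp only [Finset.mem_filter, Finset.mem_insert]
    constructor
    · rintro ⟨h1, h2⟩
      rcases Nat.eq_or_lt_of_le h2 with h3 | h3
      · exact Or.inl h3.symm
      · exact Or.inr ⟨h1, h3⟩
    · rintro (rfl | ⟨h1, h2⟩)
      · exact ⟨h, le_refl _⟩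
      · exact ⟨h1, by omega⟩
  · rw [add_zero]
    congr 1
    ext x
    simp only [Finset.mem_filter]
    constructor
    · rintro ⟨h1, h2⟩
      refine ⟨h1, ?_⟩
      rcases Nat.eq_or_lt_of_le h2 with h3 | h3
      · subst h3; exact absurd h1 h
      · exact h3
    · rintro ⟨h1, h2⟩
      exact ⟨h1, by omega⟩

theorem cntGe_zero (P : Finset ℕ) : cntGe P 0 = P.card := by simp [cntGe]

theorem cntGe_top {P : Finset ℕ} {K : ℕ} (h : P ⊆ Finset.range K) : cntGe P K = 0 := by
  simp only [cntGe, Finset.card_eq_zero, Finset.filter_eq_empty_iff]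
  intro x hx
  have := Finset.mem_range.1 (h hx)
  omega

theorem walk_code {p : ℕ → ℕ} (y : ℕ → ℕ) (K : ℕ)
    (hy : ∀ i < K, y i = y (i+1) ∨ y i = p (y (i+1))) (i : ℕ) (hi : i ≤ K) :
    y i = p^[cntGe ((Finset.range K).filter (fun j => y j ≠ y (j+1))) i] (y K) := by
  induction hi using Nat.decreasingInduction with
  | self => rw [cntGe_top (Finset.filter_subset _ _)]; rfl
  | of_succ k hk ih =>
    rw [cntGe_step]
    split_ifs with h
    · rw [Finset.mem_filter] at h
      rw [Function.iterate_succ_apply', ← ih]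
      exact (hy k hk).resolve_left h.2
    · rw [Finset.mem_filter, not_and, not_not] at h
      rw [add_zero, ← ih]
      exact h (Finset.mem_range.2 hk)

theorem walk_card {p : ℕ → ℕ} (hp : PTree p) (y : ℕ → ℕ) (K m d : ℕ) (hm : y K = m) (h0 : y 0 = 0)
    (hd : p^[d] m = 0) (hd' : ∀ k < d, p^[k] m ≠ 0)
    (hy : ∀ i < K, y i = y (i+1) ∨ y i = p (y (i+1))) :
    ((Finset.range K).filter (fun j => y j ≠ y (j+1))).card = d := by
  set P := (Finset.range K).filter (fun j => y j ≠ y (j+1)) with hP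
  have hc := walk_code y K hy
  rw [← hP, hm] at hc
  apply le_antisymm
  · by_contra hlt
    push Not at hlt
    have hne : P.Nonempty := by rw [← Finset.card_pos]; omega
    have hmem := P.min'_mem hne
    set j := P.min' hne
    have hj : y j ≠ y (j+1) := (Finset.mem_filter.1 hmem).2
    have hjK : j < K := Finset.mem_range.1 (Finset.mem_filter.1 hmem).1
    have h1 : cntGe P j = P.card := by
      unfold cntGe
      congr 1
      apply Finset.filter_true_of_mem
      intro x hx
      exact P.min'_le x hx
    have h2 := cntGe_step P j
    rw [if_pos hmem, h1] at h2
    have hz : ∀ k, d ≤ k → p^[k] m = 0 := by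
      intro k hk
      obtain ⟨l, rfl⟩ := Nat.exists_eq_add_of_le hk
      rw [add_comm, Function.iterate_add_apply, hd, hp.iter_zero]
    apply hj
    rw [hc j hjK.le, hc (j+1) hjK, hz _ (by omega), hz _ (by omega)]
  · by_contra hlt
    push Not at hlt
    apply hd' _ hlt
    rw [← cntGe_zero, ← hc 0 (Nat.zero_le _), h0]

theorem row_lemma (κ : Type) [Finite κ] (m : ℕ) (p : ℕ → ℕ) (hp : PTree p) (M : ℕ) (q : ℕ → ℕ)
    (hq : PTree q) : ∃ K, 0 < K ∧ ∀ c : (ℕ → ℕ) → κ,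
      (∀ y y' : ℕ → ℕ, (∀ i ≤ K, y i = y' i) → c y = c y') →
      ∃ a : ℕ → ℕ, a 0 = 0 ∧ a K = M ∧ (∀ i < K, a i = a (i+1) ∨ a i = q (a (i+1))) ∧
        (∀ i, a i ≤ M) ∧
        ∀ h₁ h₂ : ℕ → ℕ, (h₁ 0 = 0 ∧ h₁ M = m ∧ ∀ i ≤ M, h₁ (q i) = h₁ i ∨ h₁ (q i) = p (h₁ i)) →
          (h₂ 0 = 0 ∧ h₂ M = m ∧ ∀ i ≤ M, h₂ (q i) = h₂ i ∨ h₂ (q i) = p (h₂ i)) →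
          c (h₁ ∘ a) = c (h₂ ∘ a) := by
  classical
  have hex : ∃ d, p^[d] m = 0 := ⟨m, hp.iter_eq_zero le_rfl⟩
  obtain ⟨d, hd, hd'⟩ : ∃ d, p^[d] m = 0 ∧ ∀ k < d, p^[k] m ≠ 0 :=
    ⟨Nat.find hex, Nat.find_spec hex, fun k hk => Nat.find_min hex hk⟩
  obtain ⟨K, hK⟩ := fRamsey κ d M
  refine ⟨K + 1, Nat.succ_pos _, fun c hc => ?_⟩
  obtain ⟨Q, hQ, hQc, hQh⟩ := hK (fun P => c (fun i => p^[cntGe P i] m))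
    (Finset.range (K+1)) (by simp)
  have hstep : ∀ i, q^[cntGe Q i] M = q^[cntGe Q (i+1)] M ∨
      q^[cntGe Q i] M = q (q^[cntGe Q (i+1)] M) := by
    intro i
    rw [cntGe_step]
    split_ifs
    · right; rw [Function.iterate_succ_apply']
    · left; rfl
  have hle : ∀ i, q^[cntGe Q i] M ≤ M := fun i => (hq.iter_le _ _).trans (Nat.sub_le _ _)
  refine ⟨fun i => q^[cntGe Q i] M, ?_, ?_, fun i _ => hstep i, hle, ?_⟩
  · simp only [cntGe_zero, hQc]; exact hq.iter_eq_zero le_rfl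
  · simp only [cntGe_top hQ]; rfl
  · have main : ∀ h : ℕ → ℕ, (h 0 = 0 ∧ h M = m ∧ ∀ i ≤ M, h (q i) = h i ∨ h (q i) = p (h i)) →
        ∃ P ⊆ Q, P.card = d ∧ c (h ∘ (fun i => q^[cntGe Q i] M)) =
          c (fun i => p^[cntGe P i] m) := by
      rintro h ⟨h0, hM, hh⟩
      set y := h ∘ (fun i => q^[cntGe Q i] M) with hy
      have hyw : ∀ i < K + 1, y i = y (i+1) ∨ y i = p (y (i+1)) := by
        intro i _
        simp only [hy, Function.comp_apply]
        rcases hstep i with h1 | h1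
        · left; rw [h1]
        · rw [h1]; exact hh _ (hle _)
      have hyK : y (K+1) = m := by
        simp only [hy, Function.comp_apply, cntGe_top hQ]; exact hM
      have hy0 : y 0 = 0 := by
        simp only [hy, Function.comp_apply, cntGe_zero, hQc, hq.iter_eq_zero le_rfl, h0]
      refine ⟨_, ?_, walk_card hp y (K+1) m d hyK hy0 hd hd' hyw, ?_⟩
      · intro j hj
        rw [Finset.mem_filter] at hj
        by_contra hjQ
        apply hj.2
        simp only [hy, Function.comp_apply]
        rw [cntGe_step Q j, if_neg hjQ, add_zero]
      · apply hc
        intro i hi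
        have := walk_code y (K+1) hyw i hi
        rwa [hyK] at this
    intro h₁ h₂ H₁ H₂
    obtain ⟨P1, a1, b1, c1⟩ := main h₁ H₁
    obtain ⟨P2, a2, b2, c2⟩ := main h₂ H₂
    rw [c1, c2]
    exact hQh P1 P2 a1 a2 b1 b2

theorem lift_lemma (L : ℕ) (u : ℕ → ℕ) (hu : PTree u) (p : ℕ → ℕ) (hp : PTree p) (f : ℕ → ℕ)
    (hf0 : f 0 = 0) (hf : ∀ i < L, f (u i) = f i ∨ f (u i) = p (f i)) (K : ℕ) :
    ∀ y : ℕ → ℕ, y 0 = 0 → (∀ i < K, y i = y (i+1) ∨ y i = p (y (i+1))) → ∀ x < L, f x = y K →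
      ∃ a : ℕ → ℕ, a 0 = 0 ∧ a (K * (L+1) + L) = x ∧
        (∀ i < K * (L+1) + L, a i = a (i+1) ∨ a i = u (a (i+1))) ∧
        ∀ i ≤ K * (L+1) + L, a i < L ∧ f (a i) = y (i / (L+1)) := by
  classical
  let P : ℕ → ℕ := fun x => if f (u x) = f x then u x else x
  have hPs : ∀ x, P x = x ∨ P x = u x := by
    intro x; simp only [P]; split_ifs <;> simp
  have hPf : ∀ x, f (P x) = f x := by
    intro x; simp only [P]; split_ifs with h
    · exact h
    · rfl
  have hPle : ∀ x, P x ≤ x := by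
    intro x
    rcases hPs x with h | h
    · exact h.le
    · rw [h]; exact hu.le x
  have hIle : ∀ k x, P^[k] x ≤ x := by
    intro k x
    induction k with
    | zero => exact le_rfl
    | succ k ih => rw [Function.iterate_succ_apply']; exact (hPle _).trans ih
  have hIf : ∀ k x, f (P^[k] x) = f x := by
    intro k x
    induction k with
    | zero => rfl
    | succ k ih => rw [Function.iterate_succ_apply', hPf, ih]
  have hstuck : ∀ k x, P^[k] x + k ≤ x ∨ (f (u (P^[k] x)) = f (P^[k] x) → P^[k] x = 0) := by
    intro k x
    induction k with
    | zero => left; exact le_rfl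
    | succ k ih =>
      rw [Function.iterate_succ_apply']
      by_cases h : f (u (P^[k] x)) = f (P^[k] x) → P^[k] x = 0
      · right
        have : P (P^[k] x) = P^[k] x := by
          by_cases h' : f (u (P^[k] x)) = f (P^[k] x)
          · have h0 := h h'
            simp only [P, h', if_true, h0, hu.1]
          · simp only [P, h', if_false]
        rw [this]; exact h
      · have ih' := ih.resolve_right h
        push Not at h
        left
        have : P (P^[k] x) = u (P^[k] x) := by simp only [P, h.1, if_true]
        rw [this]
        have := hu.2 _ (Nat.pos_of_ne_zero h.2)
        omega
  have hz : ∀ x < L, f (u (P^[L] x)) = f (P^[L] x) → P^[L] x = 0 := by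
    intro x hx
    rcases hstuck L x with h | h
    · omega
    · exact h
  induction K with
  | zero =>
    intro y y0 _ x hx hfx
    simp only [zero_mul, zero_add]
    refine ⟨fun i => P^[L - i] x, ?_, ?_, ?_, ?_⟩
    · simp only [Nat.sub_zero]
      apply hz x hx
      have h1 : f (P^[L] x) = 0 := by rw [hIf, hfx, y0]
      rcases hf (P^[L] x) ((hIle _ _).trans_lt hx) with h | h
      · exact h
      · rw [h, h1, hp.1]
    · simp
    · intro i hi
      have : L - i = (L - (i+1)) + 1 := by omega
      simp only [this, Function.iterate_succ_apply']
      exact hPs _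
    · intro i hi
      refine ⟨(hIle _ _).trans_lt hx, ?_⟩
      rw [hIf, hfx, Nat.div_eq_of_lt (by omega)]
  | succ K ih =>
    intro y y0 hy x hx hfx
    have hzL : P^[L] x < L := (hIle _ _).trans_lt hx
    obtain ⟨x', hx'L, hx'f, hx'⟩ : ∃ x' < L, f x' = y K ∧ (x' = P^[L] x ∨ x' = u (P^[L] x)) := by
      by_cases hyy : y K = y (K+1)
      · exact ⟨P^[L] x, hzL, by rw [hIf, hfx, hyy], Or.inl rfl⟩
      · have hyp := (hy K (Nat.lt_succ_self _)).resolve_left hyy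
        refine ⟨u (P^[L] x), (hu.le _).trans_lt hzL, ?_, Or.inr rfl⟩
        have h1 : f (P^[L] x) = y (K+1) := by rw [hIf, hfx]
        rcases hf _ hzL with h | h
        · have h0 := hz x hx h
          rw [h0, hf0] at h1
          rw [h0, hu.1, hf0, hyp, ← h1, hp.1]
        · rw [h, h1, hyp]
    obtain ⟨a', a0, aK, astep, aval⟩ := ih y y0 (fun i hi => hy i (by omega)) x' hx'L hx'f
    have e1 : (K + 1) * (L + 1) + L = (K * (L + 1) + L) + L + 1 := by ring
    set N := K * (L + 1) + L with hN
    rw [e1]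
    refine ⟨fun i => if i ≤ N then a' i else P^[N + L + 1 - i] x, ?_, ?_, ?_, ?_⟩
    · simp [a0]
    · have : ¬ (N + L + 1 ≤ N) := by omega
      simp [this]
    · intro i hi
      dsimp only
      rcases lt_trichotomy i N with h | h | h
      · rw [if_pos h.le, if_pos (by omega)]
        exact astep i h
      · rw [h, if_pos le_rfl, if_neg (by omega), aK]
        have : N + L + 1 - (N + 1) = L := by omega
        rw [this]
        exact hx'
      · rw [if_neg (by omega), if_neg (by omega)]
        have : N + L + 1 - i = (N + L + 1 - (i+1)) + 1 := by omega
        rw [this, Function.iterate_succ_apply']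
        exact hPs _
    · intro i hi
      dsimp only
      split_ifs with h
      · exact aval i h
      · refine ⟨(hIle _ _).trans_lt hx, ?_⟩
        rw [hIf, hfx]
        congr 1
        symm
        rw [Nat.div_eq_iff (by omega)]
        have e2 : (K + 1) * (L + 1) = N + 1 := by rw [hN]; ring
        rw [e2]
        omega


/-- A parent function of fan type. -/
def PFan (u : ℕ → ℕ) : Prop := ∀ i, u i = 0 ∨ u i + 1 = i

theorem PFan.tree {u : ℕ → ℕ} (h : PFan u) : PTree u := by
  constructor
  · have := h 0; omega
  · intro i hi; have := h i; omega

/-- Homomorphisms of coded trees. -/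
structure THom (L : ℕ) (u : ℕ → ℕ) (M : ℕ) (q : ℕ → ℕ) (g : ℕ → ℕ) : Prop where
  z : ∀ i, L ≤ i → g i = 0
  z0 : g 0 = 0
  lt : ∀ i, g i < M
  hom : ∀ i < L, g (u i) = g i ∨ g (u i) = q (g i)

/-- Epimorphisms of coded trees. -/
structure TEpi (L : ℕ) (u : ℕ → ℕ) (M : ℕ) (q : ℕ → ℕ) (g : ℕ → ℕ) : Prop extends
    THom L u M q g where
  rig : ∀ i t, t ≤ g i → ∃ j ≤ i, g j = t
  sur : ∀ t < M, ∃ i, g i = t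

theorem THom.comp {L u M q N p g h} (hg : THom L u M q g) (hh : THom M q N p h) :
    THom L u N p (h ∘ g) where
  z := fun i hi => by simp [hg.z i hi, hh.z0]
  z0 := by simp [hg.z0, hh.z0]
  lt := fun i => hh.lt _
  hom := fun i hi => by
    simp only [Function.comp_apply]
    rcases hg.hom i hi with h1 | h1
    · left; rw [h1]
    · rw [h1]; exact hh.hom _ (hg.lt i)

theorem TEpi.comp {L u M q N p g h} (hg : TEpi L u M q g) (hh : TEpi M q N p h) :
    TEpi L u N p (h ∘ g) where
  toTHom := hg.toTHom.comp hh.toTHom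
  rig := fun i t ht => by
    obtain ⟨j, hj, rfl⟩ := hh.rig _ t ht
    obtain ⟨k, hk, rfl⟩ := hg.rig _ j hj
    exact ⟨k, hk, rfl⟩
  sur := fun t ht => by
    obtain ⟨j, rfl⟩ := hh.sur t ht
    by_cases hj : j < M
    · obtain ⟨k, rfl⟩ := hg.sur j hj
      exact ⟨k, rfl⟩
    · refine ⟨0, ?_⟩
      rw [hh.z j (by omega), Function.comp_apply, hg.z0, hh.z0]

theorem TEpi.sur' {L u M q g} (hg : TEpi L u M q g) (hL : 0 < L) (t : ℕ) (ht : t < M) :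
    ∃ i < L, g i = t := by
  obtain ⟨i, rfl⟩ := hg.sur t ht
  by_cases hi : i < L
  · exact ⟨i, hi, rfl⟩
  · exact ⟨0, hL, by rw [hg.z0, hg.z i (by omega)]⟩

theorem finite_bdd (L m : ℕ) : {x : ℕ → ℕ | (∀ i, L ≤ i → x i = 0) ∧ ∀ i, x i < m}.Finite := by
  let F : {x : ℕ → ℕ | (∀ i, L ≤ i → x i = 0) ∧ ∀ i, x i < m} → (Fin L → Fin m) :=
    fun x i => ⟨x.1 i, x.2.2 i⟩
  have hF : Function.Injective F := by
    intro x y hxy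
    apply Subtype.ext
    funext i
    by_cases hi : i < L
    · have := congrFun hxy ⟨i, hi⟩
      simpa [F] using this
    · rw [x.2.1 i (by omega), y.2.1 i (by omega)]
  have := Finite.of_injective F hF
  exact Set.toFinite _

/-- Append rows of height `K` to a fan of size `L`. -/
def extRow (L : ℕ) (u : ℕ → ℕ) (K : ℕ) (i : ℕ) : ℕ :=
  if i < L then u i else if (i - L) % K = 0 then 0 else i - 1

/-- Glue a map on a fan with maps on `B` appended rows of height `K`. -/
def glue (L K B : ℕ) (f : ℕ → ℕ) (W : ℕ → ℕ → ℕ) (i : ℕ) : ℕ :=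
  if i < L then f i else if i < L + B * K then W ((i - L) / K) ((i - L) % K + 1) else 0

theorem extRow_fan {L u K} (hL : 0 < L) (hu : PFan u) : PFan (extRow L u K) := by
  intro i
  unfold extRow
  split_ifs
  · exact hu i
  · left; rfl
  · right; omega

theorem extRow_low {L u K i} (hi : i < L) : extRow L u K i = u i := if_pos hi

theorem rk_div {K r k : ℕ} (hk : k < K) : (r * K + k) / K = r := by
  rw [mul_comm, Nat.mul_add_div (by omega), Nat.div_eq_of_lt hk, add_zero]

theorem rk_mod {K r k : ℕ} (hk : k < K) : (r * K + k) % K = k := by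
  rw [add_comm, Nat.add_mul_mod_self_right, Nat.mod_eq_of_lt hk]

theorem rk_lt {K B r k : ℕ} (hr : r < B) (hk : k < K) : r * K + k < B * K := by
  have : (r + 1) * K ≤ B * K := Nat.mul_le_mul_right _ hr
  rw [add_mul] at this
  omega

theorem rk_lt_div {K B i : ℕ} (h : i < B * K) : ∃ r < B, ∃ k < K, i = r * K + k := by
  have hK : 0 < K := by
    rcases Nat.eq_zero_or_pos K with rfl | h'
    · simp at h
    · exact h'
  refine ⟨i / K, (Nat.div_lt_iff_lt_mul hK).2 h, i % K, Nat.mod_lt _ hK, ?_⟩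
  rw [mul_comm, Nat.div_add_mod]

/-- element of row `b`, position `k` (position `0` is the root) -/
def elt (L K b k : ℕ) : ℕ := if k = 0 then 0 else L + b * K + k - 1

theorem elt_zero (L K b : ℕ) : elt L K b 0 = 0 := rfl

theorem elt_succ (L K b k : ℕ) : elt L K b (k+1) = L + (b * K + k) := by
  simp [elt]; omega

theorem extRow_elt {L u K b k} (hk : k < K) :
    extRow L u K (elt L K b (k+1)) = elt L K b k := by
  rw [elt_succ]
  unfold extRow
  rw [if_neg (by omega), Nat.add_sub_cancel_left, rk_mod hk]
  cases k with
  | zero => simp [elt]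
  | succ k => rw [if_neg (by omega), elt_succ]; omega

theorem glue_low {L K B f W i} (hi : i < L) : glue L K B f W i = f i := if_pos hi

theorem glue_elt {L K B f W b k} (hb : b < B) (hk : k < K) :
    glue L K B f W (elt L K b (k+1)) = W b (k+1) := by
  rw [elt_succ]
  unfold glue
  have := rk_lt hb hk
  rw [if_neg (by omega), if_pos (by omega), Nat.add_sub_cancel_left, rk_mod hk, rk_div hk]

theorem glue_high {L K B f W i} (hi : L + B * K ≤ i) : glue L K B f W i = 0 := by
  unfold glue
  rw [if_neg (by omega), if_neg (by omega)]

theorem glue_cases (L K B i : ℕ) : i < L ∨ (∃ b < B, ∃ k < K, i = elt L K b (k+1)) ∨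
    L + B * K ≤ i := by
  rcases lt_or_ge i L with h | h
  · exact Or.inl h
  rcases lt_or_ge i (L + B * K) with h' | h'
  · right; left
    obtain ⟨r, hr, k, hk, e⟩ := rk_lt_div (show i - L < B * K by omega)
    exact ⟨r, hr, k, hk, by rw [elt_succ]; omega⟩
  · exact Or.inr (Or.inr h')

theorem glue_hom {L u K B M q f W} (hL : 0 < L) (hu : PTree u) (hM : 0 < M) (f0 : f 0 = 0)
    (flt : ∀ i < L, f i < M) (fh : ∀ i < L, f (u i) = f i ∨ f (u i) = q (f i))
    (W0 : ∀ b < B, W b 0 = 0) (Wlt : ∀ b < B, ∀ k ≤ K, W b k < M)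
    (Wh : ∀ b < B, ∀ k < K, W b k = W b (k+1) ∨ W b k = q (W b (k+1))) :
    THom (L + B * K) (extRow L u K) M q (glue L K B f W) where
  z := fun i hi => glue_high hi
  z0 := by rw [glue_low hL, f0]
  lt := fun i => by
    rcases glue_cases L K B i with h | ⟨b, hb, k, hk, rfl⟩ | h
    · rw [glue_low h]; exact flt i h
    · rw [glue_elt hb hk]; exact Wlt b hb _ hk
    · rw [glue_high h]; exact hM
  hom := fun i hi => by
    rcases glue_cases L K B i with h | ⟨b, hb, k, hk, rfl⟩ | h
    · rw [extRow_low h, glue_low h, glue_low ((hu.le i).trans_lt h)]; exact fh i h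
    · rw [extRow_elt hk, glue_elt hb hk]
      have : glue L K B f W (elt L K b k) = W b k := by
        cases k with
        | zero => rw [elt_zero, glue_low hL, f0, W0 b hb]
        | succ k => rw [glue_elt hb (by omega)]
      rw [this]
      exact Wh b hb k hk
    · omega

theorem elt_lt {L K B b k} (hL : 0 < L) (hb : b < B) (hk : k ≤ K) : elt L K b k < L + B * K := by
  cases k with
  | zero => rw [elt_zero]; omega
  | succ k => rw [elt_succ]; have := rk_lt hb hk; omega

theorem hom_walk {L u K B M q x} (hx : THom (L + B * K) (extRow L u K) M q x) (hL : 0 < L)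
    {b k : ℕ} (hb : b < B) (hk : k < K) :
    x (elt L K b k) = x (elt L K b (k+1)) ∨ x (elt L K b k) = q (x (elt L K b (k+1))) := by
  have := hx.hom _ (elt_lt hL hb (show k + 1 ≤ K from hk))
  rwa [extRow_elt hk] at this


theorem tail_one (κ : Type) [Finite κ] (m : ℕ) (p : ℕ → ℕ) (hp : PTree p) (L : ℕ) (u : ℕ → ℕ)
    (hL : 0 < L) (hu : PFan u) (f : ℕ → ℕ) (hf : TEpi L u m p f) (B K : ℕ) :
    ∃ B' K', 0 < K' ∧ ∀ e : (ℕ → ℕ) → κ, ∃ G : ℕ → ℕ,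
      TEpi (L + B' * K') (extRow L u K') (L + B * K) (extRow L u K) G ∧ (∀ i < L, G i = i) ∧
      ∀ x₁ x₂, THom (L + B * K) (extRow L u K) m p x₁ → THom (L + B * K) (extRow L u K) m p x₂ →
        (∀ i < L, x₁ i = f i) → (∀ i < L, x₂ i = f i) → e (x₁ ∘ G) = e (x₂ ∘ G) := by
  classical
  let α := {x : ℕ → ℕ // THom (L + B * K) (extRow L u K) m p x ∧ ∀ i < L, x i = f i}
  have hα : Finite α := by
    have : {x : ℕ → ℕ | THom (L + B * K) (extRow L u K) m p x ∧ ∀ i < L, x i = f i}.Finite :=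
      (finite_bdd (L + B * K) m).subset (fun x hx => ⟨hx.1.z, hx.1.lt⟩)
    exact this
  obtain ⟨ι, hι, HJ⟩ := Combinatorics.Line.exists_mono_in_high_dimension α κ
  set N := Fintype.card ι with hN
  let ε : Fin N ≃ ι := (Fintype.equivFin ι).symm
  have hut := hu.tree
  set K' := K * (L + 1) + L with hK'
  have hlift : ∀ x : α, ∀ b : ℕ, ∃ a : ℕ → ℕ, b < B → (a 0 = 0 ∧
        (∀ i < K', a i = a (i+1) ∨ a i = u (a (i+1))) ∧
        ∀ i ≤ K', a i < L ∧ f (a i) = x.1 (elt L K b (i / (L+1)))) := by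
    intro x b
    by_cases hb : b < B
    · obtain ⟨x0, hx0, hx0'⟩ := hf.sur' hL (x.1 (elt L K b K)) (x.2.1.lt _)
      obtain ⟨a, h1, h2, h3, h4⟩ := lift_lemma L u hut p hp f hf.z0 hf.hom K
        (fun k => x.1 (elt L K b k)) (by simp only [elt_zero, x.2.1.z0])
        (fun i hi => hom_walk x.2.1 hL hb hi) x0 hx0 hx0'
      exact ⟨a, fun _ => ⟨h1, h3, h4⟩⟩
    · exact ⟨fun _ => 0, fun h => absurd h hb⟩
  choose lift hlift using hlift
  have hdivK : ∀ i ≤ K', i / (L+1) ≤ K := by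
    intro i hi
    rw [← Nat.lt_succ_iff, Nat.div_lt_iff_lt_mul (by omega)]
    rw [Nat.succ_mul]; omega
  refine ⟨N * B, K', by omega, fun e => ?_⟩
  obtain ⟨l, col, hcol⟩ := HJ (fun w => e (glue L K' (N * B) f (fun r k =>
    if h : r / B < N then (w (ε ⟨r / B, h⟩)).1 (elt L K (r % B) (k / (L+1))) else 0)))
  let WG : ℕ → ℕ → ℕ := fun r k => if h : r / B < N then
    (match l.idxFun (ε ⟨r / B, h⟩) with
      | none => elt L K (r % B) (k / (L+1))
      | some x => lift x (r % B) k) else 0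
  set G := glue L K' (N * B) (fun i => i) WG with hG
  have hrow : ∀ r < N * B, r / B < N ∧ r % B < B := by
    intro r hr
    have hB : 0 < B := by
      rcases Nat.eq_zero_or_pos B with rfl | h
      · simp at hr
      · exact h
    exact ⟨(Nat.div_lt_iff_lt_mul hB).2 hr, Nat.mod_lt _ hB⟩
  -- rows of G
  have hWG : ∀ r < N * B, ((∃ c : Fin N, c.1 = r / B ∧ l.idxFun (ε c) = none) ∧
      ∀ k, WG r k = elt L K (r % B) (k / (L+1))) ∨
      (∃ x, ∀ k, WG r k = lift x (r % B) k) := by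
    intro r hr
    obtain ⟨h1, h2⟩ := hrow r hr
    rcases hl : l.idxFun (ε ⟨r / B, h1⟩) with _ | x
    · left; refine ⟨⟨⟨r / B, h1⟩, rfl, hl⟩, ?_⟩; intro k; simp only [WG, h1, dif_pos, hl]
    · right; refine ⟨x, fun k => ?_⟩; simp only [WG, h1, dif_pos, hl]
  have hGhom : THom (L + N * B * K') (extRow L u K') (L + B * K) (extRow L u K) G := by
    apply glue_hom hL hut (by omega) rfl (fun i hi => by omega)
    · intro i hi
      right
      rw [extRow_low hi]
    · intro r hr
      rcases hWG r hr with ⟨-, h⟩ | ⟨x, h⟩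
      · rw [h, Nat.zero_div, elt_zero]
      · rw [h]; exact (hlift x _ (hrow r hr).2).1
    · intro r hr k hk
      rcases hWG r hr with ⟨-, h⟩ | ⟨x, h⟩
      · rw [h]; exact elt_lt hL (hrow r hr).2 (hdivK k hk)
      · rw [h]; have := ((hlift x _ (hrow r hr).2).2.2 k hk).1; omega
    · intro r hr k hk
      rcases hWG r hr with ⟨-, h⟩ | ⟨x, h⟩
      · rw [h, h]
        have h3 := hdivK (k+1) hk
        rw [Nat.succ_div] at h3 ⊢
        split_ifs at h3 ⊢ with h4
        · right; rw [extRow_elt (by omega)]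
        · left; rfl
      · rw [h, h]
        have h1 := (hlift x _ (hrow r hr).2).2.1 k hk
        have h2 := ((hlift x _ (hrow r hr).2).2.2 (k+1) hk).1
        rw [extRow_low h2]; exact h1
  have hvar : ∀ c : Fin N, l.idxFun (ε c) = none → ∀ b < B, ∀ k < K,
      G (elt L K' (c.1 * B + b) ((k+1) * (L+1))) = elt L K b (k+1) := by
    intro c hc b hb k hk
    have hr' : c.1 * B + b < N * B := rk_lt c.2 hb
    have e1 : (k+1) * (L+1) = ((k+1) * (L+1) - 1) + 1 := by
      have : 0 < (k+1) * (L+1) := by positivity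
      omega
    have e2 : (k+1) * (L+1) ≤ K * (L+1) := Nat.mul_le_mul_right _ hk
    rw [e1, hG, glue_elt hr' (by omega), ← e1]
    have hd : (c.1 * B + b) / B = c.1 := rk_div hb
    have hm : (c.1 * B + b) % B = b := rk_mod hb
    simp only [WG, hd, hm, c.2, dif_pos, Fin.eta, hc]
    rw [Nat.mul_div_cancel _ (by omega)]
  have hlow : ∀ i < L, G i = i := fun i hi => glue_low hi
  refine ⟨G, ⟨hGhom, ?_, ?_⟩, hlow, ?_⟩
  · intro i t ht
    by_cases htL : t < L
    · refine ⟨t, ?_, hlow t htL⟩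
      by_cases hi : i < L
      · rwa [hlow i hi] at ht
      · omega
    · rcases glue_cases L K' (N * B) i with h | ⟨r, hr, k, hk, rfl⟩ | h
      · rw [hlow i h] at ht; omega
      · rw [hG, glue_elt hr hk] at ht
        obtain ⟨h1, h2⟩ := hrow r hr
        rcases hWG r hr with ⟨⟨c, hcr, hc⟩, h⟩ | ⟨x, h⟩
        · rw [h] at ht
          have htlt : t < L + B * K := ht.trans_lt (elt_lt hL h2 (hdivK _ hk))
          obtain ⟨b, hb, k', hk', e2⟩ := rk_lt_div (show t - L < B * K by omega)
          have e3 : t = elt L K b (k'+1) := by rw [elt_succ]; omega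
          refine ⟨elt L K' (c.1 * B + b) ((k'+1) * (L+1)), ?_, by rw [hvar c hc b hb k' hk', e3]⟩
          rw [hcr]
          have hpos : 0 < (k'+1) * (L+1) := by positivity
          have e4 : (k'+1) * (L+1) ≤ K * (L+1) := Nat.mul_le_mul_right _ hk'
          obtain ⟨z, hz⟩ : ∃ z, (k'+1) * (L+1) = z + 1 := ⟨_, (Nat.succ_pred_eq_of_pos hpos).symm⟩
          have hr2 : r / B * B + r % B = r := by rw [mul_comm]; exact Nat.div_add_mod r B
          have hpos2 : 0 < (k + 1) / (L + 1) := by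
            by_contra h0
            have : (k+1) / (L+1) = 0 := Nat.eq_zero_of_not_pos h0
            rw [this, elt_zero] at ht
            omega
          obtain ⟨w, hw⟩ : ∃ w, (k+1) / (L+1) = w + 1 := ⟨_, (Nat.succ_pred_eq_of_pos hpos2).symm⟩
          have hwK : w < K := by have := hdivK (k+1) hk; omega
          rw [e3, hw, elt_succ, elt_succ] at ht
          rw [hz, elt_succ, elt_succ]
          rcases lt_trichotomy b (r % B) with hlt | heq | hgt
          · have : r / B * B + b < r := by omega
            have := rk_lt (K := K') (k := z) this (by omega)
            omega
          · rw [heq, hr2]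
            rw [heq] at ht
            have h5 : k' + 1 ≤ w + 1 := by omega
            rw [← hw, Nat.le_div_iff_mul_le (by omega)] at h5
            omega
          · have := rk_lt (K := K) (k := w) hgt hwK
            omega
        · rw [h] at ht
          have := ((hlift x _ h2).2.2 (k+1) hk).1
          omega
      · rw [hG, glue_high h] at ht
        omega
  · intro t ht
    by_cases htL : t < L
    · exact ⟨t, hlow t htL⟩
    · obtain ⟨b, hb, k', hk', e2⟩ := rk_lt_div (show t - L < B * K by omega)
      have e3 : t = elt L K b (k'+1) := by rw [elt_succ]; omega
      obtain ⟨i, hi⟩ := l.proper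
      refine ⟨_, (hvar (ε.symm i) (by simpa using hi) b hb k' hk').trans e3.symm⟩
  · have main : ∀ x, THom (L + B * K) (extRow L u K) m p x → (∀ i < L, x i = f i) →
        e (x ∘ G) = col := by
      intro x hx hxf
      rw [← hcol ⟨x, hx, hxf⟩]
      congr 1
      funext i
      rw [Function.comp_apply]
      rcases glue_cases L K' (N * B) i with h | ⟨r, hr, k, hk, rfl⟩ | h
      · rw [hlow i h, glue_low h, hxf i h]
      · rw [hG, glue_elt hr hk, glue_elt hr hk]
        obtain ⟨h1, h2⟩ := hrow r hr
        simp only [h1, dif_pos, WG]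
        rcases hl : l.idxFun (ε ⟨r / B, h1⟩) with _ | x'
        · simp [hl]
        · simp only [hl, Combinatorics.Line.coe_apply, Option.getD_some]
          have h3 := (hlift x' _ h2).2.2 (k+1) hk
          rw [hxf _ h3.1, h3.2]
      · rw [hG, glue_high h, glue_high h, hx.z0]
    intro x₁ x₂ h1 h2 h3 h4
    rw [main x₁ h1 h3, main x₂ h2 h4]

theorem tail_fin (κ : Type) [Finite κ] (m : ℕ) (p : ℕ → ℕ) (hp : PTree p) (L : ℕ) (u : ℕ → ℕ)
    (hL : 0 < L) (hu : PFan u) (F : Finset (ℕ → ℕ)) (hF : ∀ f ∈ F, TEpi L u m p f) (B K : ℕ) (hK : 0 < K) :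
    ∃ B' K', 0 < K' ∧ ∀ e : (ℕ → ℕ) → κ, ∃ G : ℕ → ℕ,
      TEpi (L + B' * K') (extRow L u K') (L + B * K) (extRow L u K) G ∧ (∀ i < L, G i = i) ∧
      ∀ f ∈ F, ∀ x₁ x₂, THom (L + B * K) (extRow L u K) m p x₁ →
        THom (L + B * K) (extRow L u K) m p x₂ →
        (∀ i < L, x₁ i = f i) → (∀ i < L, x₂ i = f i) → e (x₁ ∘ G) = e (x₂ ∘ G) := by
  classical
  induction F using Finset.induction_on with
  | empty =>
    refine ⟨B, K, hK, fun e => ⟨fun i => if i < L + B * K then i else 0, ?_, ?_, by simp⟩⟩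
    · have hut := (extRow_fan (K := K) hL hu).tree
      refine ⟨⟨?_, ?_, ?_, ?_⟩, ?_, ?_⟩
      · intro i hi; rw [if_neg (by omega)]
      · simp
      · intro i; split_ifs <;> omega
      · intro i hi
        right
        have := hut.le i
        rw [if_pos hi, if_pos (by omega)]
      · intro i t ht
        split_ifs at ht with h
        · exact ⟨t, ht, by rw [if_pos (by omega)]⟩
        · exact ⟨0, by omega, by rw [if_pos (by omega)]; omega⟩
      · intro t ht
        exact ⟨t, by rw [if_pos ht]⟩
    · intro i hi; exact if_pos (by omega)
  | insert f F hfF ih =>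
    obtain ⟨B1, K1, hK1, h1⟩ := ih (fun g hg => hF g (Finset.mem_insert_of_mem hg))
    obtain ⟨B2, K2, hK2, h2⟩ := tail_one κ m p hp L u hL hu f (hF f (Finset.mem_insert_self _ _)) B1 K1
    refine ⟨B2, K2, hK2, fun e => ?_⟩
    obtain ⟨G2, hG2, hG2l, hG2e⟩ := h2 e
    obtain ⟨G1, hG1, hG1l, hG1e⟩ := h1 (fun x => e (x ∘ G2))
    refine ⟨G1 ∘ G2, hG2.comp hG1, ?_, ?_⟩
    · intro i hi; rw [Function.comp_apply, hG2l i hi, hG1l i hi]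
    · intro g hg x₁ x₂ hx1 hx2 hf1 hf2
      rw [Finset.mem_insert] at hg
      rcases hg with rfl | hg
      · exact hG2e (x₁ ∘ G1) (x₂ ∘ G1) (hG1.toTHom.comp hx1) (hG1.toTHom.comp hx2)
          (fun i hi => by rw [Function.comp_apply, hG1l i hi, hf1 i hi])
          (fun i hi => by rw [Function.comp_apply, hG1l i hi, hf2 i hi])
      · exact hG1e g hg x₁ x₂ hx1 hx2 hf1 hf2

theorem tail (κ : Type) [Finite κ] (m : ℕ) (p : ℕ → ℕ) (hp : PTree p) (L : ℕ) (u : ℕ → ℕ)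
    (hL : 0 < L) (hu : PFan u) (B K : ℕ) (hK : 0 < K) :
    ∃ B' K', 0 < K' ∧ ∀ e : (ℕ → ℕ) → κ, ∃ G : ℕ → ℕ,
      TEpi (L + B' * K') (extRow L u K') (L + B * K) (extRow L u K) G ∧ (∀ i < L, G i = i) ∧
      ∀ f, TEpi L u m p f → ∀ x₁ x₂, THom (L + B * K) (extRow L u K) m p x₁ →
        THom (L + B * K) (extRow L u K) m p x₂ →
        (∀ i < L, x₁ i = f i) → (∀ i < L, x₂ i = f i) → e (x₁ ∘ G) = e (x₂ ∘ G) := by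
  have hfin : {f : ℕ → ℕ | TEpi L u m p f}.Finite :=
    (finite_bdd L m).subset (fun x hx => ⟨hx.z, hx.lt⟩)
  obtain ⟨B', K', hK', H⟩ := tail_fin κ m p hp L u hL hu hfin.toFinset
    (fun f hf => by simpa using hf) B K hK
  refine ⟨B', K', hK', fun e => ?_⟩
  obtain ⟨G, h1, h2, h3⟩ := H e
  exact ⟨G, h1, h2, fun f hf => h3 f (by simpa using hf)⟩


theorem PTree.iter_le_sub {q : ℕ → ℕ} (hq : PTree q) (x k : ℕ) : q^[k] x ≤ x - k := by
  induction k with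
  | zero => simp
  | succ k ih =>
    rw [Function.iterate_succ_apply']
    rcases Nat.eq_zero_or_pos (q^[k] x) with h | h
    · rw [h, hq.1]; omega
    · have := hq.2 _ h; omega

theorem pigeon_s13 (κ : Type) [Finite κ] (M : ℕ) (q : ℕ → ℕ) (hq : PTree q) (hM : 0 < M) :
    ∃ L u, 0 < L ∧ PFan u ∧ ∀ c : ℕ → κ, ∃ g, TEpi L u M q g ∧ ∃ fst : ℕ → ℕ, ∃ col : κ,
      ∀ t, 0 < t → t < M → g (fst t) = t ∧ (∀ j < fst t, g j < t) ∧ c (fst t) = col := by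
  classical
  have := Fintype.ofFinite κ
  set N := Fintype.card κ * M with hN
  have hz : PFan (fun _ => 0) := fun i => Or.inl rfl
  refine ⟨1 + N * M, extRow 1 (fun _ => 0) M, by omega, extRow_fan (by omega) hz, fun c => ?_⟩
  have : Nonempty κ := ⟨c 0⟩
  obtain ⟨col, -, hcol⟩ := Finset.exists_le_card_fiber_of_mul_le_card_of_maps_to
    (s := Finset.range N) (t := (Finset.univ : Finset κ)) (f := fun r => c (elt 1 M r M)) (n := M)
    (fun _ _ => Finset.mem_univ _) Finset.univ_nonempty (by simp [hN])
  obtain ⟨R, hR1, hR2⟩ := Finset.exists_subset_card_eq hcol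
  let ρ := R.orderEmbOfFin hR2
  have hρ : ∀ j, ρ j < N ∧ c (elt 1 M (ρ j) M) = col := by
    intro j
    have := hR1 (R.orderEmbOfFin_mem hR2 j)
    simpa using this
  let τ : ℕ → ℕ := fun r => if h : ∃ j, ρ j = r then (h.choose : Fin M).1 else 0
  have hτ : ∀ j, τ (ρ j) = j.1 := by
    intro j
    have h : ∃ j', ρ j' = ρ j := ⟨j, rfl⟩
    simp only [τ, dif_pos h]
    exact congrArg Fin.val (ρ.injective h.choose_spec)
  have hτM : ∀ r, τ r < M := by
    intro r
    simp only [τ]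
    split_ifs with h
    · exact h.choose.2
    · exact hM
  have hτlt : ∀ r j, r < ρ j → 0 < j.1 → τ r < j.1 := by
    intro r j hr hj
    by_cases h : ∃ j', ρ j' = r
    · obtain ⟨j', rfl⟩ := h
      rw [hτ]
      exact ρ.lt_iff_lt.1 hr
    · simp only [τ, dif_neg h]; exact hj
  set W : ℕ → ℕ → ℕ := fun r k => q^[M - k] (τ r) with hW
  have hWle : ∀ r k, W r k ≤ τ r - (M - k) := fun r k => hq.iter_le_sub _ _
  set g := glue 1 M N (fun _ => 0) W with hg
  have hgh : THom (1 + N * M) (extRow 1 (fun _ => 0) M) M q g := by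
    apply glue_hom (by omega) hz.tree hM rfl (fun _ _ => hM) (fun _ _ => Or.inl rfl)
    · intro r hr
      have := hWle r 0
      have := hτM r
      omega
    · intro r hr k hk
      have := hWle r k
      have := hτM r
      omega
    · intro r hr k hk
      right
      simp only [hW]
      rw [← Function.iterate_succ_apply' q]
      congr 1
      omega
  obtain ⟨M', rfl⟩ : ∃ M', M = M' + 1 := ⟨M - 1, by omega⟩
  let fst : ℕ → ℕ := fun t => if h : t < M' + 1 then elt 1 (M'+1) (ρ ⟨t, h⟩) (M'+1) else 0
  have hfst : ∀ t, 0 < t → t < M' + 1 → g (fst t) = t ∧ (∀ j < fst t, g j < t) ∧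
      c (fst t) = col := by
    intro t ht htM
    simp only [fst, dif_pos htM]
    refine ⟨?_, ?_, (hρ _).2⟩
    · rw [hg, glue_elt (hρ _).1 (by omega)]
      simp [hW, hτ]
    · intro j hj
      rcases glue_cases 1 (M'+1) N j with h | ⟨b, hb, k, hk, rfl⟩ | h
      · rw [hg, glue_low h]; exact ht
      · rw [hg, glue_elt hb hk]
        have h1 := hWle b (k+1)
        rw [elt_succ, elt_succ] at hj
        rcases lt_trichotomy b (ρ ⟨t, htM⟩) with h2 | h2 | h2
        · have := hτlt _ _ h2 ht
          simp only at this
          omega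
        · rw [h2] at hj
          have := hτ ⟨t, htM⟩
          rw [← h2] at this
          simp only at this
          omega
        · have := rk_lt (K := M'+1) (k := M') h2 (by omega)
          omega
      · rw [hg, glue_high h]; exact ht
  refine ⟨g, ⟨hgh, ?_, ?_⟩, fst, col, hfst⟩
  · intro i t ht
    rcases Nat.eq_zero_or_pos t with rfl | h0
    · exact ⟨0, by omega, hgh.z0⟩
    · have h1 := hgh.lt i
      obtain ⟨h2, h3, -⟩ := hfst t h0 (by omega)
      refine ⟨fst t, ?_, h2⟩
      by_contra h4
      have := h3 i (by omega)
      omega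
  · intro t ht
    rcases Nat.eq_zero_or_pos t with rfl | h0
    · exact ⟨0, hgh.z0⟩
    · exact ⟨_, (hfst t h0 ht).1⟩

/-- The Ramsey property of a coded tree. -/
def Ram (m : ℕ) (p : ℕ → ℕ) : Prop :=
  ∀ (κ : Type) [Finite κ] (M : ℕ) (q : ℕ → ℕ), PTree q → 0 < M →
    ∃ L u, 0 < L ∧ PFan u ∧ ∀ e : (ℕ → ℕ) → κ, ∃ g, TEpi L u M q g ∧
      ∀ h₁ h₂, TEpi M q m p h₁ → TEpi M q m p h₂ → e (h₁ ∘ g) = e (h₂ ∘ g)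

theorem glue_congr {L K B f W W'} (h : ∀ b < B, ∀ k ≤ K, W b k = W' b k) :
    glue L K B f W = glue L K B f W' := by
  funext i
  rcases glue_cases L K B i with h1 | ⟨b, hb, k, hk, rfl⟩ | h1
  · rw [glue_low h1, glue_low h1]
  · rw [glue_elt hb hk, glue_elt hb hk, h b hb _ hk]
  · rw [glue_high h1, glue_high h1]

/-- restriction of a map to the first `M` elements -/
def rst (M : ℕ) (h : ℕ → ℕ) (i : ℕ) : ℕ := if i < M then h i else 0

theorem rst_low {M h i} (hi : i < M) : rst M h i = h i := if_pos hi

theorem rst_high {M h i} (hi : M ≤ i) : rst M h i = 0 := if_neg (by omega)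

theorem rst_epi {M q m p h} (m' : ℕ) (hM : 0 < M) (hq : PTree q) (hh : TEpi (M+1) q m p h)
    (hm' : 0 < m')
    (hlt : ∀ i < M, h i < m') (hsur : ∀ t < m', ∃ i < M, h i = t) : TEpi M q m' p (rst M h) where
  z := fun i hi => rst_high hi
  z0 := by rw [rst_low hM, hh.z0]
  lt := fun i => by
    by_cases hi : i < M
    · rw [rst_low hi]; exact hlt i hi
    · rw [rst_high (by omega)]; exact hm'
  hom := fun i hi => by
    rw [rst_low hi, rst_low ((hq.le i).trans_lt hi)]
    exact hh.hom i (by omega)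
  rig := fun i t ht => by
    by_cases hi : i < M
    · rw [rst_low hi] at ht
      obtain ⟨j, hj, e⟩ := hh.rig i t ht
      exact ⟨j, hj, by rw [rst_low (by omega), e]⟩
    · rw [rst_high (by omega)] at ht
      exact ⟨0, by omega, by rw [rst_low hM, hh.z0]; omega⟩
  sur := fun t ht => by
    obtain ⟨i, hi, e⟩ := hsur t ht
    exact ⟨i, by rw [rst_low hi, e]⟩

theorem FUS (m : ℕ) (p : ℕ → ℕ) (hp : PTree p) (hR : Ram m p) (κ : Type) [Finite κ] (q : ℕ → ℕ)
    (hq : PTree q) (M : ℕ) (hM : 0 < M) :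
    ∃ L u, 0 < L ∧ PFan u ∧ ∀ e : (ℕ → ℕ) → κ, ∃ g, TEpi L u M q g ∧
      ∀ h₁ h₂ n, TEpi M q (m+1) p h₁ → TEpi M q (m+1) p h₂ →
        (h₁ n = m ∧ ∀ j < n, h₁ j ≠ m) → (h₂ n = m ∧ ∀ j < n, h₂ j ≠ m) →
        e (h₁ ∘ g) = e (h₂ ∘ g) := by
  classical
  induction M, hM using Nat.le_induction with
  | base =>
    refine ⟨1, fun _ => 0, by omega, fun _ => Or.inl rfl, fun e => ⟨fun _ => 0, ?_, ?_⟩⟩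
    · refine ⟨⟨fun _ _ => rfl, rfl, fun _ => by omega, fun _ _ => Or.inl rfl⟩, ?_, ?_⟩
      · intro i t ht; exact ⟨0, by omega, by omega⟩
      · intro t ht; exact ⟨0, by omega⟩
    · intro h₁ h₂ n e1 e2 _ _
      congr 1
      funext i
      simp [e1.z0, e2.z0]
  | succ M hM ih =>
    have hM0 : 0 < M := hM
    obtain ⟨K, hK, HK⟩ := row_lemma κ m p hp M q hq
    obtain ⟨L0, u0, hL0, hu0, H0⟩ := ih
    obtain ⟨L1, u1, hL1, hu1, H1⟩ := hR ((Fin (K+1) → Fin (m+1)) → κ) L0 u0 hu0.tree hL0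
    obtain ⟨B', K', hK', H2⟩ := tail κ (m+1) p hp L1 u1 hL1 hu1 1 K hK
    refine ⟨L1 + B' * K', extRow L1 u1 K', by omega, extRow_fan hL1 hu1, fun e => ?_⟩
    obtain ⟨G, hG, hGl, hGe⟩ := H2 e
    set e2 : (ℕ → ℕ) → κ := fun x => e (x ∘ G) with he2
    obtain ⟨g1, hg1, hg1e⟩ := H1 (fun f y => e2 (glue L1 K 1 f
      (fun _ k => if h : k < K + 1 then (y ⟨k, h⟩).1 else 0)))
    obtain ⟨g0, hg0, hg0e⟩ := H0 (fun f => e2 (glue L1 K 1 (f ∘ g1) (fun _ _ => 0)))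
    obtain ⟨h0, hh0⟩ : ∃ h0, ∀ f, TEpi L0 u0 m p f → TEpi L0 u0 m p h0 := by
      by_cases hex : ∃ h0, TEpi L0 u0 m p h0
      · exact ⟨hex.choose, fun _ _ => hex.choose_spec⟩
      · exact ⟨fun _ => 0, fun f hf => absurd ⟨f, hf⟩ hex⟩
    obtain ⟨a, ha0, haK, hah, hale, hae⟩ := HK
      (fun y => e2 (glue L1 K 1 (h0 ∘ g1) (fun _ => y)))
      (fun y y' hyy => by
        show e2 _ = e2 _
        rw [glue_congr (fun b _ k hk => hyy k hk)])
    set g01 := g0 ∘ g1 with hg01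
    have hE01 : TEpi L1 u1 M q g01 := hg1.comp hg0
    set g2 := glue L1 K 1 g01 (fun _ => a) with hg2
    have hg2h : THom (L1 + 1 * K) (extRow L1 u1 K) (M+1) q g2 := by
      apply glue_hom hL1 hu1.tree (by omega) hE01.z0
        (fun i _ => (hE01.lt i).trans (Nat.lt_succ_self _)) hE01.hom
      · intro b _; exact ha0
      · intro b _ k _; exact Nat.lt_succ_of_le (hale k)
      · intro b _ k hk; exact hah k hk
    have hg2l : ∀ i < L1, g2 i = g01 i := fun i hi => glue_low hi
    have hg2E : TEpi (L1 + 1 * K) (extRow L1 u1 K) (M+1) q g2 := by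
      refine ⟨hg2h, ?_, ?_⟩
      · intro i t ht
        by_cases hi : i < L1
        · rw [hg2l i hi] at ht
          obtain ⟨j, hj, e1⟩ := hE01.rig i t ht
          exact ⟨j, hj, by rw [hg2l j (by omega), e1]⟩
        · by_cases htM : t < M
          · obtain ⟨j, hj, e1⟩ := hE01.sur' hL1 t htM
            exact ⟨j, by omega, by rw [hg2l j hj, e1]⟩
          · have := hg2h.lt i
            exact ⟨i, le_rfl, by omega⟩
      · intro t ht
        by_cases htM : t < M
        · obtain ⟨j, hj, e1⟩ := hE01.sur' hL1 t htM
          exact ⟨j, by rw [hg2l j hj, e1]⟩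
        · obtain ⟨k, rfl⟩ : ∃ k, K = k + 1 := ⟨K - 1, by omega⟩
          refine ⟨elt L1 (k+1) 0 (k+1), ?_⟩
          rw [hg2, glue_elt (by omega) (by omega), haK]
          omega
    refine ⟨g2 ∘ G, hG.comp hg2E, ?_⟩
    -- the case of early first occurrence
    have early : ∀ h n, TEpi (M+1) q (m+1) p h → (h n = m ∧ ∀ j < n, h j ≠ m) → n < M →
        TEpi M q (m+1) p (rst M h) ∧ (rst M h n = m ∧ ∀ j < n, rst M h j ≠ m) ∧
        e (h ∘ g2 ∘ G) = e2 (glue L1 K 1 ((rst M h ∘ g0) ∘ g1) (fun _ _ => 0)) := by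
      intro h n hh hn hnM
      have hr : TEpi M q (m+1) p (rst M h) := by
        apply rst_epi (m+1) hM0 hq hh (by omega) (fun i _ => hh.lt i)
        intro t ht
        obtain ⟨j, hj, e1⟩ := hh.rig n t (by omega)
        exact ⟨j, by omega, e1⟩
      refine ⟨hr, ⟨?_, ?_⟩, ?_⟩
      · rw [rst_low hnM]; exact hn.1
      · intro j hj; rw [rst_low (by omega)]; exact hn.2 j hj
      · have hc : TEpi L1 u1 (m+1) p ((rst M h ∘ g0) ∘ g1) := hg1.comp (hg0.comp hr)
        refine hGe _ hc (h ∘ g2) _ (hg2h.comp hh.toTHom) ?_ ?_ ?_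
        · apply glue_hom hL1 hu1.tree (by omega) hc.z0 (fun i _ => hc.lt i) hc.hom
          · intro b _; rfl
          · intro b _ k _; omega
          · intro b _ k _; left; rfl
        · intro i hi
          rw [Function.comp_apply, hg2l i hi]
          exact (rst_low (hE01.lt i)).symm
        · intro i hi; exact glue_low hi
    have late : ∀ h, TEpi (M+1) q (m+1) p h → (h M = m ∧ ∀ j < M, h j ≠ m) →
        e (h ∘ g2 ∘ G) = e2 (glue L1 K 1 (h0 ∘ g1) (fun _ => h ∘ a)) := by
      intro h hh hn
      have hm0 : 0 < m := by
        have := hn.2 0 hM0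
        rw [hh.z0] at this
        omega
      have hr : TEpi M q m p (rst M h) := by
        apply rst_epi m hM0 hq hh hm0
        · intro i hi
          have := hh.lt i
          have := hn.2 i hi
          omega
        · intro t ht
          obtain ⟨j, hj, e1⟩ := hh.rig M t (by omega)
          have : j ≠ M := by rintro rfl; omega
          exact ⟨j, by omega, e1⟩
      have hc := hg0.comp hr
      have hcc := hg1e _ _ hc (hh0 _ hc)
      have hc2 := congrFun hcc (fun i => ⟨h (a i.1), hh.lt _⟩)
      simp only at hc2
      have e3 : h ∘ g2 = glue L1 K 1 ((rst M h ∘ g0) ∘ g1) (fun _ => h ∘ a) := by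
        funext i
        rw [Function.comp_apply]
        rcases glue_cases L1 K 1 i with h1 | ⟨b, hb, k, hk, rfl⟩ | h1
        · rw [hg2l i h1, glue_low h1]
          exact (rst_low (hE01.lt i)).symm
        · rw [hg2, glue_elt hb hk, glue_elt hb hk]; rfl
        · rw [hg2, glue_high h1, glue_high h1, hh.z0]
      show e2 (h ∘ g2) = _
      rw [e3]
      have e4 : ∀ f, glue L1 K 1 f (fun _ => h ∘ a) = glue L1 K 1 f (fun _ k =>
          if h' : k < K + 1 then h (a k) else 0) := by
        intro f
        apply glue_congr
        intro b _ k hk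
        rw [dif_pos (by omega)]; rfl
      rw [e4, e4]
      exact hc2
    intro h₁ h₂ n hh1 hh2 hn1 hn2
    have hnM : n ≤ M := by
      by_contra hc
      have h3 := hh1.z n (by omega)
      have h4 := hn1.2 0 (by omega)
      rw [hh1.z0] at h4
      omega
    rcases lt_or_eq_of_le hnM with hlt | rfl
    · obtain ⟨a1, a2, a3⟩ := early h₁ n hh1 hn1 hlt
      obtain ⟨b1, b2, b3⟩ := early h₂ n hh2 hn2 hlt
      rw [a3, b3]
      exact hg0e _ _ n a1 b1 a2 b2
    · rw [late h₁ hh1 hn1, late h₂ hh2 hn2]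
      exact hae h₁ h₂ ⟨hh1.z0, hn1.1, fun i hi => hh1.hom i (by omega)⟩
        ⟨hh2.z0, hn2.1, fun i hi => hh2.hom i (by omega)⟩

theorem ram_succ (m : ℕ) (p : ℕ → ℕ) (hp : PTree p) (hR : Ram m p) : Ram (m+1) p := by
  classical
  intro κ _ M q hq hM
  obtain ⟨L1, u1, hL1, hu1, H1⟩ := pigeon_s13 κ M q hq hM
  obtain ⟨L, u, hL, hu, H⟩ := FUS m p hp hR κ u1 hu1.tree L1 hL1
  refine ⟨L, u, hL, hu, fun e => ?_⟩
  obtain ⟨g, hg, hge⟩ := H e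
  obtain ⟨g', hg', fst, col, hfst⟩ := H1 (fun n =>
    if h : ∃ x, TEpi L1 u1 (m+1) p x ∧ (x n = m ∧ ∀ j < n, x j ≠ m) then e (h.choose ∘ g)
    else e (fun _ => 0))
  refine ⟨g' ∘ g, hg.comp hg', ?_⟩
  rcases Nat.eq_zero_or_pos m with rfl | hm
  · intro h₁ h₂ hh1 hh2
    have : h₁ = h₂ := by
      funext i
      have := hh1.lt i
      have := hh2.lt i
      omega
    rw [this]
  have main : ∀ h, TEpi M q (m+1) p h → e (h ∘ g' ∘ g) = col := by
    intro h hh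
    have hex : ∃ t, h t = m := hh.sur m (by omega)
    set t := Nat.find hex with ht
    have ht1 : h t = m := Nat.find_spec hex
    have ht2 : ∀ j < t, h j ≠ m := fun j hj => Nat.find_min hex hj
    have ht0 : 0 < t := by
      by_contra h0
      have : t = 0 := by omega
      rw [this, hh.z0] at ht1
      omega
    have htM : t < M := by
      by_contra h0
      have := hh.z t (by omega)
      omega
    obtain ⟨h3, h4, h5⟩ := hfst t ht0 htM
    have hx : TEpi L1 u1 (m+1) p (h ∘ g') ∧ ((h ∘ g') (fst t) = m ∧
        ∀ j < fst t, (h ∘ g') j ≠ m) := by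
      refine ⟨hg'.comp hh, ?_, ?_⟩
      · rw [Function.comp_apply, h3, ht1]
      · intro j hj
        exact ht2 _ (h4 j hj)
    have hxx : ∃ x, TEpi L1 u1 (m+1) p x ∧ (x (fst t) = m ∧ ∀ j < fst t, x j ≠ m) := ⟨_, hx⟩
    rw [dif_pos hxx] at h5
    rw [← h5]
    exact hge _ _ (fst t) hx.1 hxx.choose_spec.1 hx.2 hxx.choose_spec.2
  intro h₁ h₂ hh1 hh2
  rw [main h₁ hh1, main h₂ hh2]

theorem ram_all (p : ℕ → ℕ) (hp : PTree p) (m : ℕ) : Ram m p := by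
  induction m with
  | zero =>
    intro κ _ M q hq hM
    obtain ⟨L, u, hL, hu, H⟩ := pigeon_s13 Unit M q hq hM
    refine ⟨L, u, hL, hu, fun e => ?_⟩
    obtain ⟨g, hg, -⟩ := H (fun _ => ())
    refine ⟨g, hg, fun h₁ _ hh1 _ => ?_⟩
    have := hh1.lt 0
    omega
  | succ m ih => exact ram_succ m p hp ih


/-- A coding of a fan with a chain on an initial segment of the natural numbers. -/
structure Code (A : FiniteFan) (𝒞 : Set (Set A.carrier)) (n : ℕ) (p : ℕ → ℕ)
    (ν : A.carrier → ℕ) (ni : ℕ → A.carrier) : Prop where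
  pos : 0 < n
  linv : ∀ a, ni (ν a) = a
  rinv : ∀ i < n, ν (ni i) = i
  lt : ∀ a, ν a < n
  tree : PTree p
  rel : ∀ a b, A.R a b ↔ ν a = ν b ∨ ν a = p (ν b)
  mem : ∀ C, C ∈ 𝒞 ↔ ∀ a b, ν a ≤ ν b → b ∈ C → a ∈ C

/-- coded map -/
noncomputable def enc {A B : FiniteFan} (N : ℕ) (mi : ℕ → B.carrier) (ν : A.carrier → ℕ)
    (φ : B.carrier → A.carrier) (i : ℕ) : ℕ := open Classical in if i < N then ν (φ (mi i)) else 0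

theorem enc_low {A B : FiniteFan} {N : ℕ} {mi : ℕ → B.carrier} {ν : A.carrier → ℕ}
    {φ : B.carrier → A.carrier} {i : ℕ} (hi : i < N) : enc N mi ν φ i = ν (φ (mi i)) := if_pos hi

theorem enc_high {A B : FiniteFan} {N : ℕ} {mi : ℕ → B.carrier} {ν : A.carrier → ℕ}
    {φ : B.carrier → A.carrier} {i : ℕ} (hi : N ≤ i) : enc N mi ν φ i = 0 := if_neg (by omega)

theorem enc_epi {A B : FiniteFan} {𝒞A 𝒞B n p N q ν ni μ mi} (hA : Code A 𝒞A n p ν ni)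
    (hB : Code B 𝒞B N q μ mi) {φ : B.carrier → A.carrier} (h : FcEpi B A 𝒞B 𝒞A φ) :
    TEpi N q n p (enc N mi ν φ) := by
  obtain ⟨⟨hs, hR⟩, hC⟩ := h
  have rig : ∀ i t, t ≤ enc N mi ν φ i → ∃ j ≤ i, enc N mi ν φ j = t := by
    intro i t ht
    by_cases hi : i < N
    · rw [enc_low hi] at ht
      have hCi : {x | μ x ≤ i} ∈ 𝒞B := (hB.mem _).2 (fun a b hab hb => le_trans hab hb)
      have hD : φ '' {x | μ x ≤ i} ∈ 𝒞A := by rw [← hC]; exact ⟨_, hCi, rfl⟩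
      have htn : t < n := ht.trans_lt (hA.lt _)
      obtain ⟨b, hb, e⟩ := (hA.mem _).1 hD (ni t) (φ (mi i)) (by rwa [hA.rinv t htn])
        ⟨mi i, by simp [hB.rinv i hi], rfl⟩
      refine ⟨μ b, hb, ?_⟩
      rw [enc_low (hB.lt b), hB.linv, e, hA.rinv t htn]
    · rw [enc_high (by omega)] at ht
      exact ⟨i, le_rfl, by rw [enc_high (by omega)]; omega⟩
  have z0 : enc N mi ν φ 0 = 0 := by
    obtain ⟨j, hj, e⟩ := rig 0 0 (Nat.zero_le _)
    have : j = 0 := by omega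
    rwa [this] at e
  refine ⟨⟨fun i hi => enc_high hi, z0, ?_, ?_⟩, rig, ?_⟩
  · intro i
    by_cases hi : i < N
    · rw [enc_low hi]; exact hA.lt _
    · rw [enc_high (by omega)]; exact hA.pos
  · intro i hi
    have hqi := (hB.tree.le i).trans_lt hi
    rw [enc_low hi, enc_low hqi]
    rw [← hA.rel]
    apply hR
    rw [hB.rel, hB.rinv i hi, hB.rinv _ hqi]
    exact Or.inr rfl
  · intro t ht
    obtain ⟨b, hb⟩ := hs (ni t)
    exact ⟨μ b, by rw [enc_low (hB.lt b), hB.linv, hb, hA.rinv t ht]⟩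

theorem dec_epi {A B : FiniteFan} {𝒞A 𝒞B n p N q ν ni μ mi} (hA : Code A 𝒞A n p ν ni)
    (hB : Code B 𝒞B N q μ mi) {g : ℕ → ℕ} (h : TEpi N q n p g) :
    FcEpi B A 𝒞B 𝒞A (fun b => ni (g (μ b))) := by
  refine ⟨⟨?_, ?_⟩, ?_⟩
  · intro a
    obtain ⟨i, hi, e⟩ := h.sur' hB.pos (ν a) (hA.lt a)
    exact ⟨mi i, by simp only [hB.rinv i hi, e, hA.linv]⟩
  · intro s t hst
    rw [hB.rel] at hst
    rw [hA.rel, hA.rinv _ (h.lt _), hA.rinv _ (h.lt _)]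
    rcases hst with h1 | h1
    · left; rw [h1]
    · rw [h1]; exact h.hom _ (hB.lt t)
  · ext D
    constructor
    · rintro ⟨C, hC, rfl⟩
      rw [hA.mem]
      rintro a _ hab ⟨b, hb, rfl⟩
      simp only [hA.rinv _ (h.lt _)] at hab
      obtain ⟨j, hj, e⟩ := h.rig _ _ hab
      have hjN : j < N := hj.trans_lt (hB.lt b)
      refine ⟨mi j, (hB.mem C).1 hC _ b (by rwa [hB.rinv j hjN]) hb, ?_⟩
      simp only [hB.rinv j hjN, e, hA.linv]
    · intro hD
      refine ⟨{b | ∀ j ≤ μ b, ni (g j) ∈ D}, ?_, ?_⟩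
      · rw [hB.mem]
        intro a b hab hb j hj
        exact hb j (hj.trans hab)
      · ext a
        constructor
        · rintro ⟨b, hb, rfl⟩
          exact hb _ le_rfl
        · intro ha
          have hex : ∃ j, g j = ν a := h.sur _ (hA.lt a)
          have h1 := Nat.find_spec hex
          have h2 := fun j => Nat.find_min (H := hex) (m := j)
          have hjN : Nat.find hex < N := by
            obtain ⟨i, hi, e⟩ := h.sur' hB.pos (ν a) (hA.lt a)
            exact (Nat.find_min' hex e).trans_lt hi
          refine ⟨mi (Nat.find hex), ?_, ?_⟩
          · intro j hj
            rw [hB.rinv _ hjN] at hj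
            refine (hA.mem D).1 hD _ a ?_ ha
            rw [hA.rinv _ (h.lt _)]
            by_contra hc
            obtain ⟨k, hk, e⟩ := h.rig j (ν a) (by omega)
            have h3 : ¬ k < Nat.find hex := fun h4 => h2 k h4 e
            have h4 : k = j := by omega
            rw [h4] at e
            omega
          · simp only [hB.rinv _ hjN, h1, hA.linv]

theorem PFan.iter {u : ℕ → ℕ} (hu : PFan u) (k x : ℕ) (h : u^[k] x ≠ 0) : u^[k] x + k = x := by
  induction k generalizing x with
  | zero => rfl
  | succ k ih =>
    rw [Function.iterate_succ_apply] at h ⊢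
    have h1 := ih _ h
    have h2 := hu x
    omega

/-- The order of a coded fan. -/
def codeOrd (L : ℕ) (u : ℕ → ℕ) (hu : PFan u) : PartialOrder (Fin L) where
  le i j := ∃ k, u^[k] j.1 = i.1
  lt i j := (∃ k, u^[k] j.1 = i.1) ∧ ¬ ∃ k, u^[k] i.1 = j.1
  lt_iff_le_not_ge _ _ := Iff.rfl
  le_refl i := ⟨0, rfl⟩
  le_trans := by
    rintro a b c ⟨k, hk⟩ ⟨l, hl⟩
    exact ⟨k + l, by rw [Function.iterate_add_apply, hl, hk]⟩
  le_antisymm := by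
    rintro a b ⟨k, hk⟩ ⟨l, hl⟩
    have h1 := hu.tree.iter_le k b
    have h2 := hu.tree.iter_le l a
    apply Fin.ext
    omega

/-- The fan of a code. -/
def codeFan (L : ℕ) (u : ℕ → ℕ) (hL : 0 < L) (hu : PFan u) : FiniteFan where
  carrier := Fin L
  fintype := inferInstance
  ord := codeOrd L u hu
  root := ⟨0, hL⟩
  root_le := fun a => ⟨a.1, hu.tree.iter_eq_zero le_rfl⟩
  down_chain := by
    rintro a x y ⟨k, hk⟩ ⟨l, hl⟩
    rcases le_total k l with h | h
    · right
      exact ⟨l - k, by rw [← hk, ← hl, ← Function.iterate_add_apply, Nat.sub_add_cancel h]⟩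
    · left
      exact ⟨k - l, by rw [← hk, ← hl, ← Function.iterate_add_apply, Nat.sub_add_cancel h]⟩
  up_chain := by
    intro a ha
    have ha0 : a.1 ≠ 0 := fun h => ha (Fin.ext h)
    have key : ∀ (x y : Fin L) (k l : ℕ), u^[k] x.1 = a.1 → u^[l] y.1 = a.1 → k ≤ l →
        u^[l - k] y.1 = x.1 := by
      intro x y k l hk hl hkl
      have e1 : u^[k] (u^[l - k] y.1) = a.1 := by
        rw [← Function.iterate_add_apply, Nat.add_sub_cancel' hkl, hl]
      have h1 : u^[l - k] y.1 ≠ 0 := by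
        intro h
        rw [h, hu.tree.iter_zero] at e1
        omega
      have h2 := hu.iter _ _ h1
      have h3 := hu.iter k x.1 (by rw [hk]; exact ha0)
      have h4 := hu.iter l y.1 (by rw [hl]; exact ha0)
      omega
    rintro x y ⟨k, hk⟩ ⟨l, hl⟩
    rcases le_total k l with h | h
    · left; exact ⟨l - k, key x y k l hk hl h⟩
    · right; exact ⟨k - l, key y x l k hl hk h⟩

/-- lower sets of `Fin L` -/
def codeChain (L : ℕ) : Set (Set (Fin L)) := {C | ∀ a b : Fin L, a.1 ≤ b.1 → b ∈ C → a ∈ C}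

theorem codeOrd_le {L : ℕ} {u : ℕ → ℕ} {hu : PFan u} {a b : Fin L}
    (h : (codeOrd L u hu).le a b) : a.1 ≤ b.1 := by
  obtain ⟨k, hk⟩ := h
  have := hu.tree.iter_le k b
  omega

theorem codeOrd_lt {L : ℕ} {u : ℕ → ℕ} {hu : PFan u} {a b : Fin L} :
    (codeOrd L u hu).lt a b ↔ (codeOrd L u hu).le a b ∧ a.1 < b.1 := by
  rw [(codeOrd L u hu).lt_iff_le_not_ge]
  constructor
  · rintro ⟨h1, h2⟩
    refine ⟨h1, lt_of_le_of_ne (codeOrd_le h1) (fun h3 => h2 ?_)⟩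
    rw [Fin.ext h3]
    exact (codeOrd L u hu).le_refl _
  · rintro ⟨h1, h2⟩
    refine ⟨h1, fun h3 => ?_⟩
    have h4 : b.1 ≤ a.1 := codeOrd_le (hu := hu) h3
    exact absurd h2 (not_lt.2 h4)

theorem codeFan_chain (L : ℕ) (u : ℕ → ℕ) (hL : 0 < L) (hu : PFan u) :
    DCMaxChain (codeFan L u hL hu) (codeChain L) := by
  refine ⟨?_, ?_, ?_⟩
  · intro C hC x y hxy hy
    exact hC x y (codeOrd_le (hu := hu) hxy) hy
  · intro C hC D hD _
    by_contra hc
    rw [not_or] at hc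
    obtain ⟨h1, h2⟩ := hc
    obtain ⟨x, hx, hx'⟩ := Set.not_subset.1 h1
    obtain ⟨y, hy, hy'⟩ := Set.not_subset.1 h2
    rcases le_total (x : Fin L).1 (y : Fin L).1 with h | h
    · exact hx' (hD x y h hy)
    · exact hy' (hC y x h hx)
  · intro C hC hch a b hab hb
    by_contra ha
    have hD : ({x : Fin L | x.1 ≤ a.1} : Set (Fin L)) ∈ codeChain L :=
      fun x y hxy hy => le_trans hxy hy
    have hne : ({x : Fin L | x.1 ≤ a.1} : Set (Fin L)) ≠ C := by
      intro h
      apply ha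
      rw [← h]
      exact le_refl a.1
    rcases hch (Set.mem_insert_of_mem _ hD) (Set.mem_insert _ _) hne with h | h
    · exact ha (h (le_refl a.1))
    · have h3 : b.1 ≤ a.1 := h hb
      have : a = b := Fin.ext (by omega)
      exact ha (this ▸ hb)

/-- decoding -/
def codeInv (L : ℕ) (hL : 0 < L) (i : ℕ) : Fin L := if h : i < L then ⟨i, h⟩ else ⟨0, hL⟩

theorem codeInv_low {L : ℕ} (hL : 0 < L) {i : ℕ} (h : i < L) : codeInv L hL i = ⟨i, h⟩ := dif_pos h

theorem codeOrd_rel (L : ℕ) (u : ℕ → ℕ) (hu : PFan u) (a b : Fin L) :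
    (a = b ∨ ((codeOrd L u hu).lt a b ∧ ∀ p : Fin L, (codeOrd L u hu).lt a p →
      ¬ (codeOrd L u hu).lt p b)) ↔ a.1 = b.1 ∨ a.1 = u b.1 := by
  have hlow : ∀ x : Fin L, (codeOrd L u hu).lt x b → (codeOrd L u hu).le x
      ⟨u b.1, (hu.tree.le _).trans_lt b.2⟩ := by
    intro x hx
    rw [codeOrd_lt (hu := hu)] at hx
    obtain ⟨⟨k, hk⟩, hlt⟩ := hx
    cases k with
    | zero => simp at hk; omega
    | succ k => exact ⟨k, hk⟩
  have hlow2 : (codeOrd L u hu).le ⟨u b.1, (hu.tree.le _).trans_lt b.2⟩ b := ⟨1, rfl⟩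
  constructor
  · rintro (h | ⟨h1, h2⟩)
    · left; rw [h]
    · right
      have h3 := hlow a h1
      have h4 := codeOrd_le (hu := hu) h3
      have h5 := ((codeOrd_lt (hu := hu)).1 h1).2
      have h6 : u b.1 < b.1 := hu.tree.2 _ (lt_of_le_of_lt (Nat.zero_le _) h5)
      by_contra hne
      refine h2 (⟨u b.1, (hu.tree.le _).trans_lt b.2⟩ : Fin L) ?_ ?_
      · exact (codeOrd_lt (hu := hu)).2 ⟨h3, lt_of_le_of_ne h4 hne⟩
      · exact (codeOrd_lt (hu := hu)).2 ⟨hlow2, h6⟩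
  · rintro (h | h)
    · left; exact Fin.ext h
    · have h : a.1 = u b.1 := h
      rcases Nat.eq_zero_or_pos b.1 with hb | hb
      · left
        rw [hb, hu.tree.1] at h
        exact Fin.ext (by omega)
      · right
        have ha : a = ⟨u b.1, (hu.tree.le _).trans_lt b.2⟩ := Fin.ext h
        refine ⟨(codeOrd_lt (hu := hu)).2 ⟨by rw [ha]; exact hlow2, by rw [h]; exact hu.tree.2 _ hb⟩, ?_⟩
        intro (x : Fin L) hx1 hx2
        have h1 := codeOrd_le (hu := hu) (hlow x hx2)
        have h2 := ((codeOrd_lt (hu := hu)).1 hx1).2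
        have h3 : x.1 ≤ a.1 := by rw [h]; exact h1
        exact absurd h2 (not_lt.2 h3)

theorem codeFan_code (L : ℕ) (u : ℕ → ℕ) (hL : 0 < L) (hu : PFan u) :
    Code (codeFan L u hL hu) (codeChain L) L u (fun a : Fin L => a.1)
      (codeInv L hL) where
  pos := hL
  linv := fun a => codeInv_low hL a.2
  rinv := fun i hi => congrArg Fin.val (codeInv_low hL hi)
  lt := fun a => a.2
  tree := hu.tree
  mem := fun C => Iff.rfl
  rel := fun a b => codeOrd_rel L u hu a b


/-- The linear order induced by a chain. -/
def chLe {X : Type} (𝒞 : Set (Set X)) (a b : X) : Prop := ∀ C ∈ 𝒞, b ∈ C → a ∈ C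

theorem chLe_total {X : Type} {𝒞 : Set (Set X)} (h : IsChain (· ⊆ ·) 𝒞) (a b : X) :
    chLe 𝒞 a b ∨ chLe 𝒞 b a := by
  by_contra hc
  simp only [chLe, not_or, not_forall] at hc
  obtain ⟨⟨C, hC, h1, h2⟩, D, hD, h3, h4⟩ := hc
  rcases h.total hC hD with h5 | h5
  · exact h4 (h5 h1)
  · exact h2 (h5 h3)

theorem chLe_antisymm {A : FiniteFan} {𝒞 : Set (Set A.carrier)} (h : DCMaxChain A 𝒞)
    (a b : A.carrier) (hab : chLe 𝒞 a b) (hba : chLe 𝒞 b a) : a = b := by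
  obtain ⟨h1, h2, h3⟩ := h
  by_contra hne
  letI := A.ord
  have hext : ∀ x y : A.carrier, x ≤ y → chLe 𝒞 x y := fun x y hxy C hC hy => h1 C hC x y hxy hy
  have hfin : {x : A.carrier | chLe 𝒞 x a ∧ chLe 𝒞 a x}.Finite := Set.toFinite _
  obtain ⟨x, hx, hmin⟩ : ∃ x, (chLe 𝒞 x a ∧ chLe 𝒞 a x) ∧
      ∀ z, z ≤ x → (chLe 𝒞 z a ∧ chLe 𝒞 a z) → z = x := by
    obtain ⟨x, hx⟩ := hfin.exists_minimal ⟨a, fun _ _ h => h, fun _ _ h => h⟩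
    exact ⟨x, hx.1, fun z hz hz' => le_antisymm hz (hx.2 hz' hz)⟩
  obtain ⟨y, hxy, hyx, hyne⟩ : ∃ y, chLe 𝒞 x y ∧ chLe 𝒞 y x ∧ y ≠ x := by
    by_cases hxa : x = a
    · exact ⟨b, by rw [hxa]; exact hab, by rw [hxa]; exact hba, by rw [hxa]; exact Ne.symm hne⟩
    · exact ⟨a, hx.1, hx.2, Ne.symm hxa⟩
  set D : Set A.carrier := {z | z = x ∨ ∃ C ∈ 𝒞, z ∈ C ∧ x ∉ C} with hDdef
  have hD : D ∈ 𝒞 := by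
    apply h3
    · rintro z w hzw (rfl | ⟨C, hC, hw, hxC⟩)
      · by_cases hzx : z = w
        · exact Or.inl hzx
        · right
          by_contra hc
          apply hzx
          apply hmin z hzw
          have hwz : chLe 𝒞 w z := by
            intro C hC hz
            by_contra hwC
            exact hc ⟨C, hC, hz, hwC⟩
          have hzw' := hext z w hzw
          exact ⟨fun C hC ha => hzw' C hC (hx.1 C hC ha), fun C hC hz => hx.2 C hC (hwz C hC hz)⟩
      · exact Or.inr ⟨C, hC, h1 C hC z w hzw hw, hxC⟩
    · apply h2.insert
      intro C hC _
      by_cases hxC : x ∈ C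
      · left
        rintro z (rfl | ⟨C', hC', hz, hxC'⟩)
        · exact hxC
        · rcases h2.total hC hC' with h5 | h5
          · exact absurd (h5 hxC) hxC'
          · exact h5 hz
      · right
        intro z hz
        exact Or.inr ⟨C, hC, hz, hxC⟩
  rcases hyx D hD (Or.inl rfl) with h5 | ⟨C, hC, hyC, hxC⟩
  · exact hyne h5
  · exact hxC (hxy C hC hyC)

theorem exists_par (A : FiniteFan) : ∃ par : A.carrier → A.carrier, par A.root = A.root ∧
    (∀ a, a ≠ A.root → A.covby (par a) a) := by
  classical
  letI := A.ord
  have : ∀ a, ∃ c, a ≠ A.root → A.covby c a := by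
    intro a
    by_cases ha : a = A.root
    · exact ⟨a, fun h => absurd ha h⟩
    · have hfin : {x : A.carrier | x < a}.Finite := Set.toFinite _
      obtain ⟨c, hc⟩ := hfin.exists_maximal ⟨A.root, lt_of_le_of_ne (A.root_le a) (Ne.symm ha)⟩
      refine ⟨c, fun _ => ⟨hc.1, fun p hp hpa => ?_⟩⟩
      exact absurd (hc.2 hpa (le_of_lt hp)) (not_le_of_gt hp)
  choose f hf using this
  refine ⟨fun a => if a = A.root then A.root else f a, if_pos rfl, fun a ha => ?_⟩
  simp only [if_neg ha]
  exact hf a ha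

theorem covby_unique (A : FiniteFan) {c d a : A.carrier} (hc : A.covby c a) (hd : A.covby d a) :
    c = d := by
  letI := A.ord
  have key : ∀ c d : A.carrier, A.covby c a → A.covby d a → c ≤ d → c = d := by
    intro c d hc hd h
    by_contra hne
    exact hc.2 d (lt_of_le_of_ne h hne) hd.1
  rcases A.down_chain a c d (le_of_lt hc.1) (le_of_lt hd.1) with h | h
  · exact key c d hc hd h
  · exact (key d c hd hc h).symm

theorem exists_code (A : FiniteFan) (𝒞 : Set (Set A.carrier)) (h : DCMaxChain A 𝒞) :
    ∃ n p ν ni, Code A 𝒞 n p ν ni := by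
  classical
  obtain ⟨n, ν, ni, hn, hl, hr, hlt, hle⟩ : ∃ (n : ℕ) (ν : A.carrier → ℕ) (ni : ℕ → A.carrier),
      0 < n ∧ (∀ a, ni (ν a) = a) ∧ (∀ i < n, ν (ni i) = i) ∧ (∀ a, ν a < n) ∧
      ∀ a b, ν a ≤ ν b ↔ chLe 𝒞 a b := by
    letI lo : LinearOrder A.carrier :=
      { le := chLe 𝒞
        le_refl := fun a C _ h => h
        le_trans := fun a b c h1 h2 C hC hc => h1 C hC (h2 C hC hc)
        le_antisymm := fun a b => chLe_antisymm h a b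
        le_total := chLe_total h.2.1
        toDecidableLE := Classical.decRel _ }
    let ψ := Fintype.orderIsoFinOfCardEq A.carrier (rfl : Fintype.card A.carrier = _)
    have hpos : 0 < Fintype.card A.carrier := Fintype.card_pos_iff.2 ⟨A.root⟩
    refine ⟨Fintype.card A.carrier, fun a => (ψ.symm a).1,
      fun i => if h : i < Fintype.card A.carrier then ψ ⟨i, h⟩ else A.root, hpos, ?_, ?_, ?_, ?_⟩
    · intro a; simp
    · intro i hi; simp [hi]
    · intro a; exact (ψ.symm a).2
    · intro a b; exact ψ.symm.le_iff_le
  obtain ⟨par, par0, hpar⟩ := exists_par A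
  have hinj : ∀ a b, ν a = ν b → a = b := fun a b e => by rw [← hl a, ← hl b, e]
  have hext : ∀ x y : A.carrier, A.ord.le x y → ν x ≤ ν y := fun x y hxy =>
    (hle x y).2 (fun C hC hy => h.1 C hC x y hxy hy)
  have hroot : ν A.root = 0 := by
    have h1 := hext _ _ (A.root_le (ni 0))
    rw [hr 0 hn] at h1
    omega
  have hcov : ∀ a b, A.covby a b → ν a < ν b := by
    intro a b hab
    letI := A.ord
    refine lt_of_le_of_ne (hext _ _ (le_of_lt hab.1)) (fun e => ?_)
    exact absurd (hinj a b e) (ne_of_lt hab.1)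
  have hR : ∀ a b, A.R a b ↔ a = b ∨ a = par b := by
    intro a b
    by_cases hb : b = A.root
    · rw [hb, par0]
      constructor
      · rintro (h1 | h1)
        · exact Or.inl h1
        · have := hcov _ _ h1
          omega
      · rintro (h1 | h1) <;> exact Or.inl h1
    · constructor
      · rintro (h1 | h1)
        · exact Or.inl h1
        · exact Or.inr (covby_unique A h1 (hpar b hb))
      · rintro (h1 | h1)
        · exact Or.inl h1
        · rw [h1]; exact Or.inr (hpar b hb)
  refine ⟨n, fun i => if i < n then ν (par (ni i)) else 0, ν, ni, hn, hl, hr, hlt, ⟨?_, ?_⟩, ?_, ?_⟩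
  · have : ni 0 = A.root := by rw [← hroot, hl]
    simp only [if_pos hn, this, par0, hroot]
  · intro i hi
    by_cases hin : i < n
    · simp only [if_pos hin]
      have h1 : ni i ≠ A.root := by
        intro h2
        have h3 := hr i hin
        rw [h2, hroot] at h3
        omega
      have h2 := hcov _ _ (hpar _ h1)
      rwa [hr i hin] at h2
    · simp only [if_neg hin]; exact hi
  · intro a b
    rw [hR]
    simp only [if_pos (hlt b), hl]
    constructor
    · rintro (rfl | rfl)
      · exact Or.inl rfl
      · exact Or.inr rfl
    · rintro (h1 | h1)
      · exact Or.inl (hinj _ _ h1)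
      · exact Or.inr (hinj _ _ h1)
  · intro C
    constructor
    · intro hC a b hab hb
      exact (hle a b).1 hab C hC hb
    · intro hC
      apply h.2.2
      · intro x y hxy hy
        exact hC x y (hext x y hxy) hy
      · apply h.2.1.insert
        intro D hD _
        by_cases hCD : C ⊆ D
        · exact Or.inl hCD
        · right
          obtain ⟨x, hx, hx'⟩ := Set.not_subset.1 hCD
          intro z hz
          refine hC z x ?_ hx
          rcases le_total (ν z) (ν x) with h5 | h5
          · exact h5
          · exact absurd ((hle _ _).1 h5 D hD hz) hx'

/-- The class `F_c` is a Ramsey class. -/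
theorem stmt_13 (r : ℕ) (hr : 2 ≤ r) (S T : FiniteFan)
    (𝒞S : Set (Set S.carrier)) (𝒞T : Set (Set T.carrier))
    (hS : DCMaxChain S 𝒞S) (hT : DCMaxChain T 𝒞T)
    (hne : ∃ φ : T.carrier → S.carrier, FcEpi T S 𝒞T 𝒞S φ) :
    ∃ (U : FiniteFan) (𝒞U : Set (Set U.carrier)), DCMaxChain U 𝒞U ∧
      ∀ e : (U.carrier → S.carrier) → Fin r,
        ∃ g : U.carrier → T.carrier, FcEpi U T 𝒞U 𝒞T g ∧
          ∀ h₁ h₂ : T.carrier → S.carrier,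
            FcEpi T S 𝒞T 𝒞S h₁ → FcEpi T S 𝒞T 𝒞S h₂ →
            e (h₁ ∘ g) = e (h₂ ∘ g) := by
  obtain ⟨m, p, ν, ni, cS⟩ := exists_code S 𝒞S hS
  obtain ⟨M, q, μ, mi, cT⟩ := exists_code T 𝒞T hT
  obtain ⟨L, u, hL, hu, H⟩ := ram_all p cS.tree m (Fin r) M q cT.tree cT.pos
  have cU := codeFan_code L u hL hu
  refine ⟨codeFan L u hL hu, codeChain L, codeFan_chain L u hL hu, fun e => ?_⟩
  obtain ⟨g, hg, hge⟩ := H (fun x => e (fun b : Fin L => ni (x b.1)))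
  refine ⟨fun b : Fin L => mi (g b.1), dec_epi cT cU hg, ?_⟩
  intro h₁ h₂ hh1 hh2
  have key : ∀ h : T.carrier → S.carrier, (fun b : Fin L => ni ((enc M mi ν h ∘ g) b.1)) =
      h ∘ (fun b : Fin L => mi (g b.1)) := by
    intro h
    funext b
    simp only [Function.comp_apply]
    rw [enc_low (hg.lt _), cS.linv]
  have h3 := hge _ _ (enc_epi cS cT hh1) (enc_epi cS cT hh2)
  simp only [key] at h3
  exact h3
end
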